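/- Fix integers n ≥ 2, p ≥ 1 and k ≥ 0, set N = 2p, and define the vector Λ_k = [λ₁, …, λ_N] by λ_{1+j} = k + 2j for j = 0, …, p−1 and λ_{1+p+j} = −n − k + 2 + 2j for j = 0, …, p−1. Let Q : ℝ → ℝ be a continuous function supported in [0, N] whose Fourier transform satisfies 𝓕Q(ξ) = ∫_ℝ e^{−iξt} Q(t) dt = ∏_{j=1}^{N} (e^{−λ_j} − e^{−iξ})/(iξ − λ_j) for every ξ ∈ ℝ with iξ ≠ λ_j for all j. Then φ*(ξ) := Σ_{j∈ℤ} Q(j)·e^{−iξj} ≠ 0 for every ξ ∈ ℝ. -/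

import Mathlib

open MeasureTheory
namespace TB
open Complex

/-- quasi-periodic exponential spline chain, restricted to the unit interval -/
noncomputable def ch (z : ℂ) (a : ℝ) : List ℝ → ℝ → ℂ
  | [] => fun x => cexp ((a : ℂ) * ((x : ℂ) - 1))
  | (l :: L) => fun x => cexp ((l : ℂ) * ((x : ℂ) - 1)) *
      (z⁻¹ * cexp l * (∫ s in x..1, cexp (-((l : ℂ) * s)) * ch z a L s) +
        ∫ s in (0 : ℝ)..x, cexp (-((l : ℂ) * s)) * ch z a L s)

lemma ch_deriv_aux (z : ℂ) (l : ℝ) (g : ℝ → ℂ) (hg : Continuous g) (x : ℝ) :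
    HasDerivAt (fun x : ℝ => cexp ((l : ℂ) * ((x : ℂ) - 1)) *
      (z⁻¹ * cexp l * (∫ s in x..1, cexp (-((l : ℂ) * s)) * g s) +
        ∫ s in (0 : ℝ)..x, cexp (-((l : ℂ) * s)) * g s))
      (l * (cexp ((l : ℂ) * ((x : ℂ) - 1)) *
      (z⁻¹ * cexp l * (∫ s in x..1, cexp (-((l : ℂ) * s)) * g s) +
        ∫ s in (0 : ℝ)..x, cexp (-((l : ℂ) * s)) * g s)) + (cexp (-l) - z⁻¹) * g x) x := by
  have hc : Continuous (fun s : ℝ => cexp (-((l : ℂ) * s)) * g s) := by fun_prop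
  have h1 : HasDerivAt (fun x : ℝ => ∫ s in x..1, cexp (-((l : ℂ) * s)) * g s)
      (-(cexp (-((l : ℂ) * x)) * g x)) x :=
    intervalIntegral.integral_hasDerivAt_left (hc.intervalIntegrable _ _)
      (hc.stronglyMeasurableAtFilter _ _) hc.continuousAt
  have h2 : HasDerivAt (fun x : ℝ => ∫ s in (0:ℝ)..x, cexp (-((l : ℂ) * s)) * g s)
      (cexp (-((l : ℂ) * x)) * g x) x :=
    intervalIntegral.integral_hasDerivAt_right (hc.intervalIntegrable _ _)
      (hc.stronglyMeasurableAtFilter _ _) hc.continuousAt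
  have h3 : HasDerivAt (fun x : ℝ => cexp ((l : ℂ) * ((x : ℂ) - 1)))
      (cexp ((l : ℂ) * ((x : ℂ) - 1)) * (l * 1)) x :=
    (((hasDerivAt_id x).ofReal_comp.sub_const 1).const_mul (l : ℂ)).cexp
  convert! h3.mul ((h1.const_mul (z⁻¹ * cexp l)).add h2) using 1
  simp only [Pi.add_apply]
  have e1 : cexp ((l : ℂ) * ((x : ℂ) - 1)) * cexp (-((l : ℂ) * x)) = cexp (-l) := by
    rw [← Complex.exp_add]; ring_nf
  have e2 : cexp (-(l:ℂ)) * cexp l = 1 := by rw [← Complex.exp_add]; simp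
  linear_combination (-(-z⁻¹ * cexp l * g x + g x)) * e1 + z⁻¹ * g x * e2

lemma ch_cont (z : ℂ) (a : ℝ) (L : List ℝ) : Continuous (ch z a L) := by
  induction L with
  | nil => unfold ch; fun_prop
  | cons l L ih =>
    exact continuous_iff_continuousAt.2 fun x => (ch_deriv_aux z l _ ih x).continuousAt

lemma ch_deriv (z : ℂ) (a l : ℝ) (L : List ℝ) (x : ℝ) :
    HasDerivAt (ch z a (l :: L)) (l * ch z a (l :: L) x + (cexp (-l) - z⁻¹) * ch z a L x) x :=
  ch_deriv_aux z l _ (ch_cont z a L) x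

lemma ch_bdry (z : ℂ) (hz : z ≠ 0) (a l : ℝ) (L : List ℝ) :
    ch z a (l :: L) 1 = z * ch z a (l :: L) 0 := by
  have e2 : cexp (-(l:ℂ)) * cexp l = 1 := by rw [← Complex.exp_add]; simp
  simp only [ch, intervalIntegral.integral_same]
  simp only [Complex.ofReal_one, Complex.ofReal_zero, sub_self, mul_zero, Complex.exp_zero, zero_sub,
    mul_neg, mul_one]
  field_simp
  linear_combination -(∫ s in (0 : ℝ)..1, cexp (-((l : ℂ) * s)) * ch z a L s) * e2

/-- Fourier factor -/
noncomputable def hf (l ω : ℝ) : ℂ :=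
  if I * (ω : ℂ) = (l : ℂ) then 1 else (cexp (-(l : ℂ)) - cexp (-(I * ω))) / (I * ω - l)

lemma eq_zero_of_I_mul {l ω : ℝ} (h : I * (ω : ℂ) = (l : ℂ)) : l = 0 ∧ ω = 0 := by
  have h1 := congrArg Complex.re h
  have h2 := congrArg Complex.im h
  simp at h1 h2
  exact ⟨h1.symm, h2⟩

lemma ch_coeff (z : ℂ) (a : ℝ) (L : List ℝ) (ω : ℝ) (hz : cexp (I * ω) = z) :
    (∫ x in (0 : ℝ)..1, cexp (-(I * ω * x)) * ch z a L x) =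
      ((a :: L).map (fun l => hf l ω)).prod := by
  have hz0 : z ≠ 0 := by rw [← hz]; exact Complex.exp_ne_zero _
  have hzi : z⁻¹ = cexp (-(I * ω)) := by rw [← hz, Complex.exp_neg]
  induction L with
  | nil =>
    simp only [List.map_cons, List.map_nil, List.prod_cons, List.prod_nil, mul_one, hf, ch]
    split_ifs with h
    · obtain ⟨rfl, rfl⟩ := eq_zero_of_I_mul h
      simp
    · have h' : (a : ℂ) - I * ω ≠ 0 := fun h'' => h (by linear_combination -h'')
      have h2 : I * ω - (a : ℂ) ≠ 0 := fun h'' => h (by linear_combination h'')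
      have : ∀ x : ℝ, cexp (-(I * ω * x)) * cexp ((a : ℂ) * ((x : ℂ) - 1)) =
          cexp (-a) * cexp ((a - I * ω) * x) := by
        intro x; rw [← Complex.exp_add, ← Complex.exp_add]; ring_nf
      simp_rw [this]
      rw [intervalIntegral.integral_const_mul, integral_exp_mul_complex h']
      have e : cexp (-(a:ℂ)) * cexp (a - I * ω) = cexp (-(I * ω)) := by
        rw [← Complex.exp_add]; ring_nf
      field_simp
      simp
      linear_combination (I * ω - a) * e
  | cons l L ih =>
    have key : (∫ x in (0 : ℝ)..1, cexp (-(I * ω * x)) * ch z a (l :: L) x) =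
        hf l ω * ∫ x in (0 : ℝ)..1, cexp (-(I * ω * x)) * ch z a L x := by
      unfold hf
      split_ifs with h
      · obtain ⟨rfl, rfl⟩ := eq_zero_of_I_mul h
        have hz1 : z = 1 := by rw [← hz]; simp
        subst hz1
        have : ∀ x, ch 1 a (0 :: L) x = ∫ x in (0:ℝ)..1, ch 1 a L x := by
          intro x
          simp only [ch]
          simp
          rw [add_comm, intervalIntegral.integral_add_adjacent_intervals] <;>
          exact (ch_cont _ _ _).intervalIntegrable _ _
        simp [this]
      · have h2 : I * ω - (l : ℂ) ≠ 0 := fun h'' => h (by linear_combination h'')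
        have hd : ∀ x ∈ Set.uIcc (0:ℝ) 1, HasDerivAt (fun x : ℝ => cexp (-(I * ω * x)) * ch z a (l :: L) x)
            ((cexp (-l) - z⁻¹) * (cexp (-(I * ω * x)) * ch z a L x) -
              (I * ω - l) * (cexp (-(I * ω * x)) * ch z a (l :: L) x)) x := by
          intro x _
          have h3 : HasDerivAt (fun x : ℝ => cexp (-(I * ω * x)))
              (cexp (-(I * ω * x)) * (-(I * ω * 1))) x :=
            (((hasDerivAt_id x).ofReal_comp.const_mul (I * ω)).neg).cexp
          convert! h3.mul (ch_deriv z a l L x) using 1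
          ring
        have hc1 := ch_cont z a L
        have hc2 := ch_cont z a (l :: L)
        have hi := intervalIntegral.integral_eq_sub_of_hasDerivAt hd
          (Continuous.intervalIntegrable (by fun_prop) _ _)
        rw [intervalIntegral.integral_sub (Continuous.intervalIntegrable (by fun_prop) _ _)
          (Continuous.intervalIntegrable (by fun_prop) _ _),
          intervalIntegral.integral_const_mul, intervalIntegral.integral_const_mul, ch_bdry z hz0] at hi
        have e : cexp (-(I * ω)) * z = 1 := by rw [← hz, ← Complex.exp_add]; simp
        simp at hi
        rw [← mul_assoc, e] at hi
        rw [← hzi]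
        rw [div_mul_eq_mul_div, eq_div_iff h2]
        linear_combination -hi
    rw [key, ih]
    simp [mul_left_comm]


lemma hf_bound (l ω : ℝ) (hω : ω ≠ 0) : ‖hf l ω‖ ≤ (Real.exp (-l) + 1) / |ω| := by
  have h : ¬ I * (ω : ℂ) = l := fun h => hω (eq_zero_of_I_mul h).2
  rw [hf, if_neg h, norm_div]
  have h1 : ‖cexp (-(l : ℂ)) - cexp (-(I * ω))‖ ≤ Real.exp (-l) + 1 := by
    refine (norm_sub_le _ _).trans ?_
    rw [Complex.norm_exp, Complex.norm_exp]
    simp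
  have h2 : |ω| ≤ ‖I * (ω : ℂ) - l‖ := by
    have := Complex.abs_im_le_norm (I * (ω : ℂ) - l)
    simpa using this
  have := abs_pos.2 hω
  gcongr

lemma prod_bound (L : List ℝ) : ∃ C : ℝ, 0 ≤ C ∧ ∀ ω : ℝ, ω ≠ 0 →
    ‖(L.map (fun l => hf l ω)).prod‖ ≤ C / |ω| ^ L.length := by
  induction L with
  | nil => exact ⟨1, by simp⟩
  | cons l L ih =>
    obtain ⟨C, hC, h⟩ := ih
    refine ⟨(Real.exp (-l) + 1) * C, by positivity, fun ω hω => ?_⟩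
    have h1 := mul_le_mul (hf_bound l ω hω) (h ω hω) (norm_nonneg _) (by positivity)
    simp only [List.map_cons, List.prod_cons, norm_mul, List.length_cons]
    refine h1.trans (le_of_eq ?_)
    rw [div_mul_div_comm, pow_succ']

lemma summable_prod (L : List ℝ) (hL : 2 ≤ L.length) (ξ : ℝ) :
    Summable (fun m : ℤ => (L.map (fun l => hf l (ξ + 2 * Real.pi * m))).prod) := by
  obtain ⟨C, hC, h⟩ := prod_bound L
  have hs := (((Real.summable_one_div_int_add_rpow (ξ / (2 * Real.pi)) 2).2 (by norm_num)).mul_left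
    (C / (2 * Real.pi) ^ 2))
  refine Summable.of_norm_bounded_eventually hs ?_
  have hev : ∀ᶠ m : ℤ in Filter.cofinite, 1 ≤ |ξ + 2 * Real.pi * m| := by
    have h1 : Filter.Tendsto (fun m : ℤ => |ξ + 2 * Real.pi * m|) Filter.cofinite Filter.atTop := by
      rw [Int.cofinite_eq, Filter.tendsto_sup]
      constructor
      · refine Filter.tendsto_abs_atBot_atTop.comp ?_
        exact Filter.tendsto_atBot_add_const_left _ _ ((tendsto_intCast_atBot_iff.2 Filter.tendsto_id).const_mul_atBot (by positivity))
      · refine Filter.tendsto_abs_atTop_atTop.comp ?_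
        exact Filter.tendsto_atTop_add_const_left _ _ ((tendsto_intCast_atTop_iff.2 Filter.tendsto_id).const_mul_atTop (by positivity))
    exact h1.eventually_ge_atTop 1
  filter_upwards [hev] with m hm
  have hne : ξ + 2 * Real.pi * m ≠ 0 := by
    intro h0; rw [h0] at hm; norm_num at hm
  refine (h _ hne).trans ?_
  have e : |ξ + 2 * Real.pi * m| = (2 * Real.pi) * |m + ξ / (2 * Real.pi)| := by
    rw [← abs_of_pos (show (0:ℝ) < 2 * Real.pi by positivity), ← abs_mul,
      abs_of_pos (show (0:ℝ) < 2 * Real.pi by positivity)]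
    congr 1
    field_simp
    ring
  have e2 : C / (2 * Real.pi) ^ 2 * (1 / |m + ξ / (2 * Real.pi)| ^ (2:ℝ)) = C / |ξ + 2 * Real.pi * m| ^ 2 := by
    rw [e, Real.rpow_two, div_mul_div_comm, mul_one, ← mul_pow]
  rw [e2]
  have : |ξ + 2 * Real.pi * m| ^ 2 ≤ |ξ + 2 * Real.pi * m| ^ L.length := pow_le_pow_right₀ hm hL
  gcongr

lemma hasSum_ch (a l : ℝ) (L : List ℝ) (ξ : ℝ) :
    HasSum (fun m : ℤ => ((a :: l :: L).map (fun l => hf l (ξ + 2 * Real.pi * m))).prod)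
      (ch (cexp (I * ξ)) a (l :: L) 0) := by
  set z := cexp (I * ξ) with hz
  let f : ℝ → ℂ := fun x => cexp (-(I * ξ * x)) * ch z a (l :: L) x
  have hfc : Continuous f := by
    have := ch_cont z a (l :: L)
    fun_prop
  have hf01 : f 0 = f 1 := by
    simp only [f]
    rw [ch_bdry z (Complex.exp_ne_zero _), hz, ← mul_assoc, ← Complex.exp_add]
    simp
  let F : C(UnitAddCircle, ℂ) := ⟨AddCircle.liftIco 1 0 f,
    AddCircle.liftIco_zero_continuous hf01 hfc.continuousOn⟩
  have hco : ∀ m : ℤ, fourierCoeff F m =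
      ((a :: l :: L).map (fun l => hf l (ξ + 2 * Real.pi * m))).prod := by
    intro m
    have hw : cexp (I * ((ξ + 2 * Real.pi * m : ℝ) : ℂ)) = z := by
      rw [hz, Complex.exp_eq_exp_iff_exists_int]
      exact ⟨m, by push_cast; ring⟩
    rw [← ch_coeff z a (l :: L) _ hw]
    show fourierCoeff (AddCircle.liftIco 1 0 f) m = _
    rw [fourierCoeff_liftIco_eq, fourierCoeffOn_eq_integral]
    simp only [zero_add, sub_zero, div_one, one_smul]
    refine intervalIntegral.integral_congr fun x _ => ?_
    simp only [f, fourier_coe_apply, smul_eq_mul, ← mul_assoc, ← Complex.exp_add]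
    congr 2
    push_cast
    ring
  have hs := has_pointwise_sum_fourier_series_of_summable (f := F) (by
    rw [funext hco]; exact summable_prod _ (by simp) ξ) ((0:ℝ) : UnitAddCircle)
  have hF0 : F ((0:ℝ) : UnitAddCircle) = ch z a (l :: L) 0 := by
    show AddCircle.liftIco 1 0 f _ = _
    rw [AddCircle.liftIco_zero_coe_apply (by simp)]
    simp [f]
  rw [hF0] at hs
  convert! hs using 2 with m
  rw [hco]
  simp

lemma poisson (Q : ℝ → ℝ) (hQc : Continuous Q) (A : ℝ)
    (hQsupp : Function.support Q ⊆ Set.Icc (0 : ℝ) A) (L : List ℝ) (hL : 2 ≤ L.length)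
    (hQF : ∀ ξ : ℝ, (∫ t : ℝ, cexp (-(I * ξ * t)) * Q t) = (L.map (fun l => hf l ξ)).prod) (ξ : ℝ) :
    (∑' j : ℤ, (Q j : ℂ) * cexp (-(I * ξ * j))) =
      ∑' m : ℤ, (L.map (fun l => hf l (ξ + 2 * Real.pi * m))).prod := by
  let f : ℝ → ℂ := fun t => Q t * cexp (-(I * ξ * t))
  have hfc : Continuous f := by fun_prop
  have hF : ∀ m : ℤ, Real.instFourierTransform.fourier f (m : ℝ) = (L.map (fun l => hf l (ξ + 2 * Real.pi * m))).prod := by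
    intro m
    rw [← hQF, Real.fourier_real_eq_integral_exp_smul]
    congr 1
    ext t
    simp only [f, smul_eq_mul]
    rw [mul_left_comm, ← Complex.exp_add, mul_comm]
    congr 2
    push_cast
    ring
  have hp := Real.tsum_eq_tsum_fourier_of_rpow_decay_of_summable (f := f) hfc (b := 2) (by norm_num)
    (by
      refine Asymptotics.IsBigO.of_bound 1 ?_
      have : ∀ᶠ x in Filter.cocompact ℝ, x ∉ Set.Icc 0 A := isCompact_Icc.compl_mem_cocompact
      filter_upwards [this] with x hx
      have : Q x = 0 := by
        by_contra h
        exact hx (hQsupp h)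
      simp [f, this]
      positivity) (by
      have := summable_prod L hL ξ
      convert! this using 2 with m
      exact hF m) 0
  have e : ∀ j : ℤ, (Q j : ℂ) * cexp (-(I * ξ * j)) = f (0 + j) := by intro j; simp [f]
  simp_rw [e, hp]
  refine tsum_congr fun m => ?_
  have := hF m
  rw [← this]
  simp

open Topology in
lemma hf_tendsto (l : ℝ) : Filter.Tendsto (hf l) (𝓝[≠] 0) (𝓝 (hf l 0)) := by
  by_cases hl : l = 0
  · subst hl
    have h3 : HasDerivAt (fun x : ℝ => cexp (-(I * x))) (cexp (-(I * (0:ℝ))) * (-(I * 1))) 0 :=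
      ((((hasDerivAt_id (0:ℝ)).ofReal_comp.const_mul I)).neg).cexp
    have h4 := (hasDerivAt_iff_tendsto_slope.1 h3).mul_const I
    have e : cexp (-(I * (0:ℝ))) * (-(I * 1)) * I = hf 0 0 := by simp [hf]
    rw [e] at h4
    refine h4.congr' ?_
    filter_upwards [self_mem_nhdsWithin] with ω hω
    have hω : ω ≠ 0 := hω
    have hω' : (ω : ℂ) ≠ 0 := by exact_mod_cast hω
    have h : ¬ I * (ω : ℂ) = (0:ℝ) := fun h => hω (eq_zero_of_I_mul h).2
    rw [hf, if_neg h, slope_def_module]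
    simp
    field_simp
    rw [Complex.I_sq]; ring
  · have h : ∀ ω : ℝ, ¬ I * (ω : ℂ) = l := fun ω h => hl (eq_zero_of_I_mul h).1
    have h2 : ∀ ω : ℝ, I * (ω : ℂ) - l ≠ 0 := fun ω h' => h ω (by linear_combination h')
    have : hf l = fun ω : ℝ => (cexp (-(l : ℂ)) - cexp (-(I * ω))) / (I * ω - l) := by
      ext ω; rw [hf, if_neg (h ω)]
    have hc : Continuous (hf l) := by
      rw [this]
      exact Continuous.div (by fun_prop) (by fun_prop) h2
    exact (hc.tendsto 0).mono_left nhdsWithin_le_nhds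

open Topology in
lemma prod_tendsto (L : List ℝ) : Filter.Tendsto (fun ω => (L.map (fun l => hf l ω)).prod) (𝓝[≠] 0)
    (𝓝 ((L.map (fun l => hf l 0)).prod)) := by
  induction L with
  | nil => simp
  | cons l L ih => simpa using (hf_tendsto l).mul ih

lemma ft_extend (Q : ℝ → ℝ) (hQc : Continuous Q) (A : ℝ)
    (hQsupp : Function.support Q ⊆ Set.Icc (0 : ℝ) A) (L : List ℝ)
    (hQF : ∀ ξ : ℝ, ξ ≠ 0 →
      (∫ t : ℝ, cexp (-(I * ξ * t)) * Q t) = (L.map (fun l => hf l ξ)).prod) (ξ : ℝ) :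
    (∫ t : ℝ, cexp (-(I * ξ * t)) * Q t) = (L.map (fun l => hf l ξ)).prod := by
  by_cases hξ : ξ = 0
  · subst hξ
    have hQint : Integrable Q := hQc.integrable_of_hasCompactSupport
      (HasCompactSupport.intro isCompact_Icc (K := Set.Icc 0 A) fun x hx => by
        by_contra h; exact hx (hQsupp h))
    have hc : Continuous (fun ξ : ℝ => ∫ t : ℝ, cexp (-(I * ξ * t)) * Q t) := by
      refine continuous_of_dominated (bound := fun t => ‖Q t‖) ?_ ?_ hQint.norm ?_
      · intro ξ
        exact (Continuous.aestronglyMeasurable (by fun_prop))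
      · intro ξ
        refine Filter.Eventually.of_forall fun t => ?_
        rw [norm_mul, Complex.norm_exp]
        simp
      · refine Filter.Eventually.of_forall fun t => ?_
        fun_prop
    have h1 := (hc.tendsto 0).mono_left (nhdsWithin_le_nhds (s := {0}ᶜ))
    refine tendsto_nhds_unique h1 ((prod_tendsto L).congr' ?_)
    filter_upwards [self_mem_nhdsWithin] with ω hω
    exact (hQF ω hω).symm
  · exact hQF ξ hξ

/-- The key identity. -/
lemma key_identity (Q : ℝ → ℝ) (hQc : Continuous Q) (A : ℝ)
    (hQsupp : Function.support Q ⊆ Set.Icc (0 : ℝ) A) (L' : List ℝ)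
    (hQF : ∀ ξ : ℝ, ξ ≠ 0 →
      (∫ t : ℝ, cexp (-(I * ξ * t)) * Q t) = (L'.map (fun l => hf l ξ)).prod)
    (a l : ℝ) (L : List ℝ) (hL : L'.Perm (a :: l :: L)) (ξ : ℝ) :
    HasSum (fun m : ℤ => (L'.map (fun l => hf l (ξ + 2 * Real.pi * m))).prod)
      (∑' j : ℤ, (Q j : ℂ) * cexp (-(I * ξ * j))) ∧
    (∑' j : ℤ, (Q j : ℂ) * cexp (-(I * ξ * j))) = ch (cexp (I * ξ)) a (l :: L) 0 := by
  have h1 := poisson Q hQc A hQsupp L' (by rw [hL.length_eq]; simp)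
    (ft_extend Q hQc A hQsupp L' hQF) ξ
  have h2 := hasSum_ch a l L ξ
  have h3 : ∀ ω : ℝ, (L'.map (fun l => hf l ω)).prod =
      ((a :: l :: L).map (fun l => hf l ω)).prod := fun ω => (hL.map _).prod_eq
  simp_rw [h3] at h1 ⊢
  rw [h1, h2.tsum_eq]
  exact ⟨h2, rfl⟩

lemma ch_one_pos (a : ℝ) (L : List ℝ) :
    ∀ x ∈ Set.Icc (0:ℝ) 1, ∃ r : ℝ, 0 < r ∧ ch 1 a L x = r := by
  induction L with
  | nil => intro x _; exact ⟨Real.exp (a * (x - 1)), Real.exp_pos _, by simp [ch]⟩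
  | cons l L ih =>
    intro x hx
    have hre : ∀ s ∈ Set.Icc (0:ℝ) 1, ch 1 a L s = ((ch 1 a L s).re : ℂ) ∧ 0 < (ch 1 a L s).re := by
      intro s hs
      obtain ⟨r, hr, h⟩ := ih s hs
      rw [h]; simpa using hr
    have hc : Continuous (fun s => Real.exp (-(l * s)) * (ch 1 a L s).re) := by
      have := Complex.continuous_re.comp (ch_cont 1 a L)
      have h2 : Continuous fun s => (ch 1 a L s).re := this
      fun_prop
    have hI : ∀ u v : ℝ, 0 ≤ u → u ≤ v → v ≤ 1 → (∫ s in u..v, cexp (-((l : ℂ) * s)) * ch 1 a L s) =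
        ((∫ s in u..v, Real.exp (-(l * s)) * (ch 1 a L s).re : ℝ) : ℂ) := by
      intro u v hu huv hv
      rw [← intervalIntegral.integral_ofReal]
      refine intervalIntegral.integral_congr fun s hs => ?_
      rw [Set.uIcc_of_le huv] at hs
      have := (hre s ⟨hu.trans hs.1, hs.2.trans hv⟩).1
      rw [this]
      simp
    have hpos : ∀ u v : ℝ, 0 ≤ u → u < v → v ≤ 1 →
        0 < ∫ s in u..v, Real.exp (-(l * s)) * (ch 1 a L s).re := by
      intro u v hu huv hv
      refine intervalIntegral.intervalIntegral_pos_of_pos_on (hc.intervalIntegrable _ _) ?_ huv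
      intro s hs
      exact mul_pos (Real.exp_pos _) (hre s ⟨hu.trans hs.1.le, hs.2.le.trans hv⟩).2
    refine ⟨Real.exp (l * (x - 1)) * (Real.exp l * (∫ s in x..1, Real.exp (-(l * s)) * (ch 1 a L s).re)
      + ∫ s in (0:ℝ)..x, Real.exp (-(l * s)) * (ch 1 a L s).re), ?_, ?_⟩
    · refine mul_pos (Real.exp_pos _) ?_
      rcases hx.2.lt_or_eq with h | h
      · have h1 := hpos x 1 hx.1 h le_rfl
        have h2 : 0 ≤ ∫ s in (0:ℝ)..x, Real.exp (-(l * s)) * (ch 1 a L s).re := by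
          rcases hx.1.lt_or_eq with h' | h'
          · exact (hpos 0 x le_rfl h' hx.2).le
          · rw [← h']; simp
        positivity
      · subst h
        have := hpos 0 1 le_rfl zero_lt_one le_rfl
        simpa using this
    · simp only [ch]
      rw [hI x 1 hx.1 hx.2 le_rfl, hI 0 x le_rfl hx.1 hx.2]
      simp

/-- global quasi-periodic extension -/
noncomputable def Fx (ξ a : ℝ) (L : List ℝ) (x : ℝ) : ℂ :=
  cexp (I * ξ * x) * (cexp (-(I * ξ * (Int.fract x : ℝ))) * ch (cexp (I * ξ)) a L (Int.fract x))

lemma Fx_eq (ξ a : ℝ) (L : List ℝ) (x : ℝ) (m : ℤ) (hm : ⌊x⌋ = m) :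
    Fx ξ a L x = cexp (I * ξ) ^ m * ch (cexp (I * ξ)) a L (x - m) := by
  have h : Int.fract x = x - m := by rw [← hm]; rfl
  rw [Fx, h, ← mul_assoc, ← Complex.exp_add, ← Complex.exp_int_mul]
  congr 2
  push_cast; ring

lemma Fx_cont (ξ a l : ℝ) (L : List ℝ) : Continuous (Fx ξ a (l :: L)) := by
  unfold Fx
  refine Continuous.mul (by fun_prop) ?_
  have hc := ch_cont (cexp (I * ξ)) a (l :: L)
  refine ContinuousOn.comp_fract'' (f := fun x : ℝ => cexp (-(I * ξ * x)) * ch (cexp (I * ξ)) a (l :: L) x) ?_ ?_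
  · exact Continuous.continuousOn (by fun_prop)
  · rw [ch_bdry _ (Complex.exp_ne_zero _), ← mul_assoc, ← Complex.exp_add]
    simp

lemma Fx_deriv (ξ a l : ℝ) (L : List ℝ) (x : ℝ) :
    HasDerivWithinAt (Fx ξ a (l :: L))
      (l * Fx ξ a (l :: L) x + (cexp (-l) - (cexp (I * ξ))⁻¹) * Fx ξ a L x) (Set.Ici x) x := by
  set m := ⌊x⌋ with hm
  have h1 : HasDerivAt (fun y : ℝ => cexp (I * ξ) ^ m * ch (cexp (I * ξ)) a (l :: L) (y - m))
      (l * Fx ξ a (l :: L) x + (cexp (-l) - (cexp (I * ξ))⁻¹) * Fx ξ a L x) x := by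
    have := ((ch_deriv (cexp (I * ξ)) a l L (x - m)).comp_sub_const x m).const_mul (cexp (I * ξ) ^ m)
    convert! this using 1
    rw [Fx_eq _ _ _ _ m hm.symm, Fx_eq _ _ _ _ m hm.symm]
    ring
  refine h1.hasDerivWithinAt.congr_of_eventuallyEq ?_ (Fx_eq _ _ _ _ m hm.symm)
  have : Set.Ico x (m + 1) ∈ nhdsWithin x (Set.Ici x) := by
    exact Ico_mem_nhdsGE (Int.lt_floor_add_one x)
  filter_upwards [this] with y hy
  refine Fx_eq _ _ _ _ m ?_
  rw [Int.floor_eq_iff]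
  exact ⟨(Int.floor_le x).trans hy.1, hy.2⟩

lemma rolle_step (ξ a l : ℝ) (L : List ℝ) (w : ℂ) (σ y x : ℝ) (hyx : y < x)
    (h : Real.exp (-(l * y)) * (σ * (w * Fx ξ a (l :: L) y).re) <
      Real.exp (-(l * x)) * (σ * (w * Fx ξ a (l :: L) x).re)) :
    ∃ t, y ≤ t ∧ t < x ∧
      0 < σ * (w * (cexp (-l) - (cexp (I * ξ))⁻¹) * Fx ξ a L t).re := by
  by_contra hcon
  push Not at hcon
  have hF := Fx_cont ξ a l L
  have hcF : Continuous (fun x => (w * Fx ξ a (l :: L) x).re) :=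
    Complex.continuous_re.comp (continuous_const.mul hF)
  have hd : ∀ t ∈ Set.Ico y x, HasDerivWithinAt
      (fun x => Real.exp (-(l * x)) * (σ * (w * Fx ξ a (l :: L) x).re))
      (Real.exp (-(l * t)) * (σ * (w * (cexp (-l) - (cexp (I * ξ))⁻¹) * Fx ξ a L t).re))
      (Set.Ici t) t := by
    intro t _
    have h1 := ((Fx_deriv ξ a l L t).const_mul w)
    have h2 : HasDerivWithinAt (fun x => (w * Fx ξ a (l :: L) x).re)
      (w * (l * Fx ξ a (l :: L) t + (cexp (-l) - (cexp (I * ξ))⁻¹) * Fx ξ a L t)).re (Set.Ici t) t := by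
      exact (Complex.reCLM.hasFDerivAt.comp_hasDerivWithinAt t h1)
    have h3 : HasDerivAt (fun x : ℝ => Real.exp (-(l * x))) (Real.exp (-(l * t)) * (-(l * 1))) t :=
      (((hasDerivAt_id t).const_mul l).neg).exp
    convert! h3.hasDerivWithinAt.mul (h2.const_mul σ) using 1
    have : (w * (l * Fx ξ a (l :: L) t + (cexp (-l) - (cexp (I * ξ))⁻¹) * Fx ξ a L t)).re =
        l * (w * Fx ξ a (l :: L) t).re + (w * (cexp (-l) - (cexp (I * ξ))⁻¹) * Fx ξ a L t).re := by
      rw [← Complex.re_ofReal_mul, ← Complex.add_re]; ring_nf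
    rw [this]; ring
  have := image_le_of_deriv_right_le_deriv_boundary (B' := fun _ => 0)
    (B := fun _ => Real.exp (-(l * y)) * (σ * (w * Fx ξ a (l :: L) y).re)) (a := y) (b := x)
    (Continuous.continuousOn (by fun_prop)) hd le_rfl continuousOn_const
    (fun t _ => hasDerivWithinAt_const _ _ _)
    (fun t ht => mul_nonpos_of_nonneg_of_nonpos (Real.exp_pos _).le (hcon t ht.1 ht.2))
    (Set.right_mem_Icc.2 hyx.le)
  linarith

/-- alternation chains -/
inductive Alt (f : ℝ → ℝ) : ℕ → ℝ → ℝ → Prop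
  | zero {x σ : ℝ} (hx : 0 ≤ x) (h : 0 < σ * f x) : Alt f 0 x σ
  | succ {K : ℕ} {x y σ τ : ℝ} (hy : Alt f K y τ) (hyx : y < x) (hs : τ * σ < 0)
      (h : 0 < σ * f x) : Alt f (K + 1) x σ

lemma Alt.nonneg {f : ℝ → ℝ} {K : ℕ} {x σ : ℝ} (h : Alt f K x σ) : 0 ≤ x := by
  induction h with
  | zero hx _ => exact hx
  | succ _ hyx _ _ ih => linarith

lemma Alt.pos {f : ℝ → ℝ} {K : ℕ} {x σ : ℝ} (h : Alt f K x σ) : 0 < σ * f x := by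
  cases h <;> assumption

lemma neg_of_opp {τ σ r : ℝ} (h : τ * σ < 0) (h2 : 0 < τ * r) : σ * r < 0 := by
  rcases mul_neg_iff.1 h with ⟨h3, h4⟩ | ⟨h3, h4⟩
  · exact mul_neg_of_neg_of_pos h4 (pos_of_mul_pos_right h2 h3.le)
  · exact mul_neg_of_pos_of_neg h4 (by nlinarith)

lemma Alt.descend (ξ a l : ℝ) (L : List ℝ) (w : ℂ) (K : ℕ) : ∀ (x σ : ℝ),
    Alt (fun x => (w * Fx ξ a (l :: L) x).re) (K + 1) x σ →
    ∃ t < x, Alt (fun x => (w * (cexp (-l) - (cexp (I * ξ))⁻¹) * Fx ξ a L x).re) K t σ := by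
  induction K with
  | zero =>
    intro x σ h
    cases h with
    | succ hy hyx hs h =>
      rename_i y τ
      have h1 := neg_of_opp hs hy.pos
      have hp := Real.exp_pos (-(l * y))
      have hq := Real.exp_pos (-(l * x))
      obtain ⟨t, ht1, ht2, ht3⟩ := rolle_step ξ a l L w σ y x hyx
        ((mul_neg_of_pos_of_neg hp h1).trans (mul_pos hq h))
      exact ⟨t, ht2, Alt.zero (hy.nonneg.trans ht1) ht3⟩
  | succ K ih =>
    intro x σ h
    cases h with
    | succ hy hyx hs h =>
      rename_i y τ
      have h1 := neg_of_opp hs hy.pos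
      have hp := Real.exp_pos (-(l * y))
      have hq := Real.exp_pos (-(l * x))
      obtain ⟨t, ht1, ht2, ht3⟩ := rolle_step ξ a l L w σ y x hyx
        ((mul_neg_of_pos_of_neg hp h1).trans (mul_pos hq h))
      obtain ⟨t', ht', hA⟩ := ih y τ hy
      exact ⟨t, ht2, Alt.succ hA (ht'.trans_le ht1) hs ht3⟩

lemma Alt.bound_nil (ξ a : ℝ) (w : ℂ) {K : ℕ} {x σ : ℝ}
    (h : Alt (fun x => (w * Fx ξ a [] x).re) K x σ) : (K : ℤ) ≤ ⌊x⌋ := by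
  have hF : ∀ x, (w * Fx ξ a [] x).re =
      Real.exp (a * (x - ⌊x⌋ - 1)) * (w * cexp (I * ξ) ^ ⌊x⌋).re := by
    intro x
    rw [Fx_eq _ _ _ x _ rfl, ← Complex.re_ofReal_mul]
    congr 1
    simp [ch]
    ring
  induction h with
  | zero hx _ => simpa using Int.floor_nonneg.2 hx
  | succ hy hyx hs h ih =>
    rename_i K x y σ τ
    have h1 := neg_of_opp hs hy.pos
    simp only [hF] at h1 h
    have hle : ⌊y⌋ ≤ ⌊x⌋ := Int.floor_mono hyx.le
    have hne : ⌊y⌋ ≠ ⌊x⌋ := by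
      intro he
      rw [he, mul_left_comm] at h1
      rw [mul_left_comm] at h
      have h2 := pos_of_mul_pos_right h (Real.exp_pos _).le
      have := mul_pos (Real.exp_pos (a * (y - ⌊x⌋ - 1))) h2
      linarith
    push_cast
    omega

lemma Alt.bound (ξ a : ℝ) (L : List ℝ) : ∀ (w : ℂ) (K : ℕ) (x σ : ℝ),
    Alt (fun x => (w * Fx ξ a L x).re) K x σ → (K : ℤ) ≤ ⌊x⌋ + L.length := by
  induction L with
  | nil => intro w K x σ h; simpa using h.bound_nil
  | cons l L ih =>
    intro w K x σ h
    cases K with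
    | zero =>
      have := Int.floor_nonneg.2 h.nonneg
      push_cast; omega
    | succ K =>
      obtain ⟨t, ht, hA⟩ := Alt.descend ξ a l L w K x σ h
      have := ih _ _ _ _ hA
      have h2 : ⌊t⌋ ≤ ⌊x⌋ := Int.floor_mono ht.le
      simp only [List.length_cons]
      push_cast; omega

lemma non_alt (s : ℕ → ℝ) (c : ℝ) (hc : -1 < c) (hs : ∀ m, s (m + 2) = 2 * c * s (m + 1) - s m)
    (m0 : ℕ) : ¬ ∀ j, s (m0 + j) * s (m0 + j + 1) < 0 := by
  intro h
  have hr : ∀ j, 0 < -s (m0 + j + 1) / s (m0 + j) := by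
    intro j
    have h1 := h j
    have hne : s (m0 + j) ≠ 0 := by intro h0; rw [h0] at h1; simp at h1
    have : -s (m0 + j + 1) / s (m0 + j) = -(s (m0 + j) * s (m0 + j + 1)) / s (m0 + j) ^ 2 := by
      field_simp
    rw [this]
    have : 0 < s (m0 + j) ^ 2 := by positivity
    apply div_pos <;> linarith
  have hstep : ∀ j, -s (m0 + j + 2) / s (m0 + j + 1) ≤ -s (m0 + j + 1) / s (m0 + j) - 2 * (1 + c) := by
    intro j
    have h1 := h j
    have hne : s (m0 + j) ≠ 0 := by intro h0; rw [h0] at h1; simp at h1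
    have hne2 : s (m0 + j + 1) ≠ 0 := by intro h0; rw [h0] at h1; simp at h1
    have hp := hr j
    set r := -s (m0 + j + 1) / s (m0 + j) with hrd
    have e : -s (m0 + j + 2) / s (m0 + j + 1) = -2 * c - 1 / r := by
      rw [hs, hrd]; field_simp; ring
    rw [e]
    have : 2 ≤ r + 1 / r := by
      have : r + 1 / r - 2 = (r - 1) ^ 2 / r := by field_simp; ring
      have h2 : 0 ≤ (r - 1) ^ 2 / r := by positivity
      linarith
    linarith
  have hall : ∀ j : ℕ, -s (m0 + j + 1) / s (m0 + j) ≤ -s (m0 + 0 + 1) / s (m0 + 0) - j * (2 * (1 + c)) := by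
    intro j
    induction j with
    | zero => simp
    | succ j ih =>
      have := hstep j
      push_cast
      have e : m0 + (j + 1) + 1 = m0 + j + 2 := by ring
      rw [e, ← add_assoc]
      linarith
  obtain ⟨j, hj⟩ := exists_nat_gt ((-s (m0 + 0 + 1) / s (m0 + 0)) / (2 * (1 + c)))
  rw [div_lt_iff₀ (by linarith)] at hj
  have := hall j
  have := hr j
  linarith

lemma ch_ne (z : ℂ) (a : ℝ) (L : List ℝ) (hz : ∀ l : ℝ, cexp (-l) - z⁻¹ ≠ 0) :
    ∃ x ∈ Set.Ioo (0:ℝ) 1, ch z a L x ≠ 0 := by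
  induction L with
  | nil => exact ⟨1/2, by norm_num, Complex.exp_ne_zero _⟩
  | cons l L ih =>
    by_contra hcon
    push Not at hcon
    obtain ⟨x, hx, hne⟩ := ih
    have h1 := ch_deriv z a l L x
    have h2 : HasDerivAt (ch z a (l :: L)) 0 x := by
      refine (hasDerivAt_const x (0:ℂ)).congr_of_eventuallyEq ?_
      filter_upwards [isOpen_Ioo.mem_nhds hx] with y hy using hcon y hy
    have h3 := h1.unique h2
    rw [hcon x hx, mul_zero, zero_add] at h3
    exact (mul_ne_zero (hz l) hne) h3

lemma kappa_ne (ξ : ℝ) (hξ : cexp (I * ξ) ≠ 1) (l : ℝ) : cexp (-l) - (cexp (I * ξ))⁻¹ ≠ 0 := by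
  intro h
  have h1 : cexp (-l) = cexp (-(I * ξ)) := by rw [Complex.exp_neg (I * ξ)]; linear_combination h
  have h2 := congrArg norm h1
  rw [Complex.norm_exp, Complex.norm_exp] at h2
  simp at h2
  subst h2
  have h3 : (cexp (I * ξ))⁻¹ = 1 := by rw [← Complex.exp_neg, ← h1]; simp
  exact hξ (inv_eq_one.1 h3)

theorem ch_ne_zero_generic (ξ a l : ℝ) (L : List ℝ) (h1 : cexp (I * ξ) ≠ 1)
    (h2 : cexp (I * ξ) ≠ -1) : ch (cexp (I * ξ)) a (l :: L) 0 ≠ 0 := by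
  intro h0
  obtain ⟨x0, hx0, hv⟩ := ch_ne (cexp (I * ξ)) a (l :: L) (kappa_ne ξ h1)
  set z := cexp (I * ξ) with hz
  have hz0 : z ≠ 0 := Complex.exp_ne_zero _
  set v := ch z a (l :: L) x0 with hvd
  -- generic choice
  obtain ⟨τ, hτ⟩ : ∃ τ : ℝ, τ ∉ Set.range (fun m : ℕ => (z ^ m * v).re / (z ^ m * v).im) := by
    by_contra hcon
    push Not at hcon
    have hu : Set.range (fun m : ℕ => (z ^ m * v).re / (z ^ m * v).im) = Set.univ :=
      Set.eq_univ_of_forall hcon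
    have := Set.countable_range (fun m : ℕ => (z ^ m * v).re / (z ^ m * v).im)
    rw [hu] at this
    exact Set.not_countable_univ this
  set w : ℂ := 1 + τ * I with hw
  set s : ℕ → ℝ := fun m => (w * (z ^ m * v)).re with hs
  have hsne : ∀ m, s m ≠ 0 := by
    intro m hm
    have hne : z ^ m * v ≠ 0 := mul_ne_zero (pow_ne_zero _ hz0) hv
    have e : (z ^ m * v).re = τ * (z ^ m * v).im := by
      simp only [hs, hw] at hm
      rw [Complex.mul_re] at hm
      simp only [Complex.add_re, Complex.add_im, Complex.one_re, Complex.one_im, Complex.re_ofReal_mul,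
        Complex.im_ofReal_mul, Complex.I_re, Complex.I_im] at hm
      linarith
    by_cases him : (z ^ m * v).im = 0
    · rw [him, mul_zero] at e
      exact hne (Complex.ext e him)
    · exact hτ ⟨m, by simp only; rw [e]; field_simp⟩
  have hrec : ∀ m, s (m + 2) = 2 * Real.cos ξ * s (m + 1) - s m := by
    intro m
    have hzz : z ^ 2 = 2 * (Real.cos ξ : ℂ) * z - 1 := by
      have : z = Complex.cos ξ + Complex.sin ξ * I := by rw [hz, mul_comm, Complex.exp_mul_I]
      rw [this]
      push_cast
      linear_combination Complex.sin_sq_add_cos_sq (ξ : ℂ) * (-1) + Complex.sin ξ ^ 2 * Complex.I_sq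
    have : w * (z ^ (m + 2) * v) = ((2 * Real.cos ξ : ℝ) : ℂ) * (w * (z ^ (m + 1) * v)) - w * (z ^ m * v) := by
      push_cast
      push_cast at hzz
      linear_combination w * z ^ m * v * hzz
    simp only [hs]
    rw [this, Complex.sub_re, Complex.re_ofReal_mul]
  have hcos : -1 < Real.cos ξ := by
    rcases (Real.neg_one_le_cos ξ).lt_or_eq with h | h
    · exact h
    · exfalso
      apply h2
      have hsin : Real.sin ξ = 0 := by
        have := Real.sin_sq_add_cos_sq ξ
        rw [← h] at this
        nlinarith
      rw [hz, mul_comm, Complex.exp_mul_I, ← Complex.ofReal_cos, ← Complex.ofReal_sin, ← h, hsin]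
      simp
  have hFm : ∀ m : ℕ, Fx ξ a (l :: L) m = 0 := by
    intro m
    rw [Fx_eq ξ a (l :: L) m m (by simp)]
    simp [← hz, h0]
  have hFx : ∀ m : ℕ, (w * Fx ξ a (l :: L) (m + x0)).re = s m := by
    intro m
    rw [Fx_eq ξ a (l :: L) (m + x0) m (by
      rw [Int.floor_eq_iff]; push_cast; exact ⟨by linarith [hx0.1], by linarith [hx0.2]⟩)]
    simp only [hs, hvd, ← hz]
    simp
  set κ := cexp (-l) - z⁻¹ with hκ
  set D : ℝ → ℝ := fun x => (w * κ * Fx ξ a L x).re with hD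
  have ht1 : ∀ m : ℕ, ∃ t, (m : ℝ) ≤ t ∧ t < m + x0 ∧ 0 < s m * D t := by
    intro m
    refine rolle_step ξ a l L w (s m) m (m + x0) (by linarith [hx0.1]) ?_
    rw [hFm, hFx]
    have := mul_self_pos.2 (hsne m)
    simp only [mul_zero, Complex.zero_re]
    positivity
  have ht2 : ∀ m : ℕ, ∃ t, (m : ℝ) + x0 ≤ t ∧ t < m + 1 ∧ 0 < -s m * D t := by
    intro m
    refine rolle_step ξ a l L w (-s m) (m + x0) (m + 1) (by linarith [hx0.2]) ?_
    have := hFm (m + 1)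
    push_cast at this
    rw [this, hFx]
    have := mul_self_pos.2 (hsne m)
    simp only [mul_zero, Complex.zero_re]
    apply mul_neg_of_pos_of_neg (Real.exp_pos _)
    linarith
  have hP : ∀ C : ℕ, ∃ m : ℕ, ∃ t, t < (m : ℝ) + 1 ∧ Alt D (m + C) t (-s m) := by
    intro C
    induction C with
    | zero =>
      obtain ⟨t, h3, h4, h5⟩ := ht2 0
      refine ⟨0, t, h4, Alt.zero ?_ h5⟩
      have := hx0.1
      push_cast at h3
      linarith
    | succ C ih =>
      by_contra hcon
      push Not at hcon
      obtain ⟨m, hm⟩ := ih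
      have step : ∀ m : ℕ, (∃ t, t < (m : ℝ) + 1 ∧ Alt D (m + C) t (-s m)) →
          s m * s (m + 1) < 0 ∧ (∃ t, t < ((m + 1 : ℕ) : ℝ) + 1 ∧ Alt D (m + 1 + C) t (-s (m + 1))) := by
        rintro m ⟨t, ht, hA⟩
        obtain ⟨t1, h3, h4, h5⟩ := ht1 (m + 1)
        obtain ⟨t2, h6, h7, h8⟩ := ht2 (m + 1)
        push_cast at h3
        have hsg : s m * s (m + 1) < 0 := by
          by_contra hpos
          have hpos' : 0 < s m * s (m + 1) :=
            lt_of_le_of_ne (not_lt.1 hpos) (mul_ne_zero (hsne _) (hsne _)).symm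
          have A1 : Alt D (m + C + 1) t1 (s (m + 1)) := Alt.succ hA (by linarith) (by linarith) h5
          have A2 : Alt D (m + C + 1 + 1) t2 (-s (m + 1)) :=
            Alt.succ A1 (by linarith) (by have := mul_self_pos.2 (hsne (m+1)); linarith) h8
          refine hcon (m + 1) t2 h7 ?_
          convert! A2 using 1
          ring
        refine ⟨hsg, t2, h7, ?_⟩
        have A2 : Alt D (m + C + 1) t2 (-s (m + 1)) :=
            Alt.succ hA (by linarith [hx0.1]) (by linarith) h8
        convert! A2 using 1
        ring
      have hall : ∀ j : ℕ, (∃ t, t < ((m + j : ℕ) : ℝ) + 1 ∧ Alt D (m + j + C) t (-s (m + j))) := by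
        intro j
        induction j with
        | zero => simpa using hm
        | succ j ih => exact (step _ ih).2
      exact non_alt s (Real.cos ξ) hcos hrec m fun j => (step _ (hall j)).1
  obtain ⟨m, t, ht, hA⟩ := hP (L.length + 1)
  have hb := Alt.bound ξ a L _ _ _ _ hA
  have : ⌊t⌋ < (m : ℤ) + 1 := by
    rw [Int.floor_lt]; push_cast; exact ht
  push_cast at hb
  omega

section transc
open Polynomial

theorem e_transc_int : ¬ IsAlgebraic ℤ (cexp 1) := by
  intro halg
  obtain ⟨q, hq0, hq⟩ := halg.exists_nonzero_coeff_and_aeval_eq_zero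
    (mem_nonZeroDivisors_of_ne_zero (Complex.exp_ne_zero _))
  set d := q.natDegree with hd
  let f : ℤ[X] := ∏ i ∈ Finset.range d, (X - C ((i : ℤ) + 1))
  have hf0 : f.eval 0 ≠ 0 := by
    simp only [f, eval_prod, eval_sub, eval_X, eval_C, Finset.prod_ne_zero_iff]
    intro i _; omega
  have hfmonic : f.Monic := monic_prod_of_monic _ _ fun i _ => monic_X_sub_C _
  have hroot : ∀ i ∈ Finset.range d, ((i : ℂ) + 1) ∈ f.aroots ℂ := by
    intro i hi
    rw [mem_aroots]
    refine ⟨hfmonic.ne_zero, ?_⟩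
    simp only [f, map_prod]
    refine Finset.prod_eq_zero hi ?_
    simp
  obtain ⟨c, hc⟩ := LindemannWeierstrass.exp_polynomial_approx f hf0
  set A : ℝ := ∑ i ∈ Finset.range d, |(q.coeff (i + 1) : ℝ)| with hA
  have hA0 : 0 ≤ A := Finset.sum_nonneg fun _ _ => abs_nonneg _
  -- choose a prime
  have hlim : Filter.Tendsto (fun m : ℕ => A * (|c| * (|c| ^ m / (m.factorial : ℝ)))) Filter.atTop (nhds 0) := by
    have := ((FloorSemiring.tendsto_pow_div_factorial_atTop |c|).const_mul |c|).const_mul A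
    simpa using this
  obtain ⟨m0, hm0⟩ := Filter.eventually_atTop.1 (hlim.eventually (gt_mem_nhds (zero_lt_one)))
  obtain ⟨p, hp1, hp⟩ := Nat.exists_infinite_primes (m0 + (eval 0 f).natAbs + (q.coeff 0).natAbs + 1)
  obtain ⟨n, hpn, gp, -, happ⟩ := hc p (by omega) hp
  have hsmall := hm0 (p - 1) (by omega)
  set G : ℕ → ℤ := fun i => gp.eval ((i : ℤ) + 1) with hG
  have hGe : ∀ i : ℕ, aeval ((i : ℂ) + 1) gp = (G i : ℂ) := by
    intro i
    have : ((i : ℂ) + 1) = algebraMap ℤ ℂ ((i : ℤ) + 1) := by simp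
    rw [this, aeval_algebraMap_apply_eq_algebraMap_eval]
    simp [hG]
  have hsum : (q.coeff 0 : ℂ) + ∑ i ∈ Finset.range d, (q.coeff (i + 1) : ℂ) * cexp ((i : ℂ) + 1) = 0 := by
    rw [← hq, aeval_eq_sum_range, Finset.sum_range_succ']
    rw [add_comm]
    congr 1
    · refine Finset.sum_congr rfl fun i _ => ?_
      rw [← Complex.exp_nat_mul]
      simp
    · simp
  set Z : ℤ := n * q.coeff 0 + p * ∑ i ∈ Finset.range d, q.coeff (i + 1) * G i with hZ
  have hZne : Z ≠ 0 := by
    intro h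
    have hdv : (p : ℤ) ∣ n * q.coeff 0 := by
      refine ⟨-∑ i ∈ Finset.range d, q.coeff (i + 1) * G i, ?_⟩
      linarith
    rcases (Nat.prime_iff_prime_int.1 hp).dvd_or_dvd hdv with h1 | h1
    · exact hpn h1
    · have := Nat.le_of_dvd (Int.natAbs_pos.2 hq0) (Int.natCast_dvd.1 h1)
      omega
  have hZeq : (Z : ℂ) = -∑ i ∈ Finset.range d, (q.coeff (i + 1) : ℂ) *
      (n • cexp ((i : ℂ) + 1) - p • aeval ((i : ℂ) + 1) gp) := by
    simp_rw [hGe]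
    rw [hZ]
    push_cast
    simp only [zsmul_eq_mul, nsmul_eq_mul, mul_sub, Finset.sum_sub_distrib]
    rw [Finset.mul_sum]
    have e1 : ∑ i ∈ Finset.range d, (q.coeff (i + 1) : ℂ) * (n * cexp ((i : ℂ) + 1)) =
        n * ∑ i ∈ Finset.range d, (q.coeff (i + 1) : ℂ) * cexp ((i : ℂ) + 1) := by
      rw [Finset.mul_sum]; exact Finset.sum_congr rfl fun i _ => by ring
    have e2 : ∑ i ∈ Finset.range d, (q.coeff (i + 1) : ℂ) * (p * (G i : ℂ)) =
        ∑ i ∈ Finset.range d, (p : ℂ) * ((q.coeff (i + 1) : ℂ) * (G i : ℂ)) :=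
      Finset.sum_congr rfl fun i _ => by ring
    rw [e1, e2]
    linear_combination n * hsum
  have hZle : ‖(Z : ℂ)‖ ≤ A * (|c| ^ p / ((p - 1).factorial : ℝ)) := by
    rw [hZeq, norm_neg, hA, Finset.sum_mul]
    refine (norm_sum_le _ _).trans (Finset.sum_le_sum fun i hi => ?_)
    rw [norm_mul]
    refine mul_le_mul (by simp) ((happ (hroot i hi)).trans ?_) (norm_nonneg _) (abs_nonneg _)
    exact div_le_div_of_nonneg_right ((le_abs_self _).trans (by rw [abs_pow])) (by positivity)
  have hpp : |c| ^ p = |c| * |c| ^ (p - 1) := by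
    rw [← pow_succ']; congr 1; have := hp.pos; omega
  rw [hpp, mul_div_assoc] at hZle
  have hZ1 : (1 : ℝ) ≤ ‖(Z : ℂ)‖ := by
    rw [Complex.norm_intCast]
    exact_mod_cast Int.one_le_abs hZne
  linarith

theorem e_transc (P : ℚ[X]) (hP : aeval (cexp 1) P = 0) : P = 0 := by
  by_contra hne
  have h : IsAlgebraic ℚ (cexp 1) := ⟨P, hne, hP⟩
  exact e_transc_int ((IsFractionRing.isAlgebraic_iff ℤ ℚ ℂ).2 h)

end transc

section val
open Polynomial

def Val (ζ x c : ℂ) : Prop := ∃ A B : ℚ[X], aeval ζ B ≠ 0 ∧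
  x * aeval (cexp 1) B = aeval (cexp 1) A ∧ c * aeval ζ B = aeval ζ A

lemma Val.den_ne {ζ : ℂ} {B : ℚ[X]} (h : aeval ζ B ≠ 0) : aeval (cexp 1) B ≠ 0 := by
  intro h0
  rw [e_transc B h0] at h
  simp at h

lemma Val.zero {ζ c : ℂ} (h : Val ζ 0 c) : c = 0 := by
  obtain ⟨A, B, h1, h2, h3⟩ := h
  rw [zero_mul] at h2
  rw [e_transc A h2.symm] at h3
  simpa [h1] using h3

lemma Val.rat (ζ : ℂ) (q : ℚ) : Val ζ q q := by
  refine ⟨C q, 1, by simp, ?_, ?_⟩ <;> simp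

lemma Val.add {ζ x c y d : ℂ} (h : Val ζ x c) (h' : Val ζ y d) : Val ζ (x + y) (c + d) := by
  obtain ⟨A, B, h1, h2, h3⟩ := h
  obtain ⟨A', B', h1', h2', h3'⟩ := h'
  refine ⟨A * B' + A' * B, B * B', by simp [h1, h1'], ?_, ?_⟩
  · simp only [map_mul, map_add]; rw [← h2, ← h2']; ring
  · simp only [map_mul, map_add]; rw [← h3, ← h3']; ring

lemma Val.mul {ζ x c y d : ℂ} (h : Val ζ x c) (h' : Val ζ y d) : Val ζ (x * y) (c * d) := by
  obtain ⟨A, B, h1, h2, h3⟩ := h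
  obtain ⟨A', B', h1', h2', h3'⟩ := h'
  refine ⟨A * A', B * B', by simp [h1, h1'], ?_, ?_⟩
  · simp only [map_mul]; rw [← h2, ← h2']; ring
  · simp only [map_mul]; rw [← h3, ← h3']; ring

lemma Val.inv {ζ x c : ℂ} (h : Val ζ x c) (hc : c ≠ 0) : Val ζ x⁻¹ c⁻¹ := by
  obtain ⟨A, B, h1, h2, h3⟩ := h
  have hA : aeval ζ A ≠ 0 := by rw [← h3]; exact mul_ne_zero hc h1
  have hA' := Val.den_ne hA
  have hx : x ≠ 0 := by rintro rfl; exact hA' (by rw [← h2]; simp)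
  refine ⟨B, A, hA, ?_, ?_⟩
  · rw [← h2]; field_simp
  · rw [← h3]; field_simp

lemma Val.e (ζ : ℂ) : Val ζ (cexp 1) ζ := ⟨X, 1, by simp, by simp, by simp⟩

lemma Val.pow {ζ x c : ℂ} (h : Val ζ x c) (m : ℕ) : Val ζ (x ^ m) (c ^ m) := by
  induction m with
  | zero => simpa using Val.rat ζ 1
  | succ m ih => rw [pow_succ, pow_succ]; exact ih.mul h

lemma Val.expz {ζ : ℂ} (hζ : ζ ≠ 0) (m : ℤ) : Val ζ (cexp m) (ζ ^ m) := by
  have : cexp m = cexp 1 ^ m := by rw [← Complex.exp_int_mul]; simp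
  rw [this]
  cases m with
  | ofNat m => simpa using (Val.e ζ).pow m
  | negSucc m =>
    rw [zpow_negSucc, zpow_negSucc]
    exact ((Val.e ζ).pow _).inv (pow_ne_zero _ hζ)

end val

def RR (ζ x : ℂ) : Prop := ∃ c, Val ζ x c

lemma RR.rat (ζ : ℂ) (q : ℚ) : RR ζ q := ⟨_, Val.rat ζ q⟩
lemma RR.add {ζ x y : ℂ} : RR ζ x → RR ζ y → RR ζ (x + y) := fun ⟨_, h⟩ ⟨_, h'⟩ => ⟨_, h.add h'⟩
lemma RR.mul {ζ x y : ℂ} : RR ζ x → RR ζ y → RR ζ (x * y) := fun ⟨_, h⟩ ⟨_, h'⟩ => ⟨_, h.mul h'⟩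
lemma RR.neg {ζ x : ℂ} (h : RR ζ x) : RR ζ (-x) := by
  have := (RR.rat ζ (-1)).mul h
  simpa using this
lemma RR.zero (ζ : ℂ) : RR ζ 0 := by simpa using RR.rat ζ 0
lemma RR.one (ζ : ℂ) : RR ζ 1 := by simpa using RR.rat ζ 1

inductive Wm (ζ : ℂ) (M : ℕ) : (ℝ → ℂ) → Prop
  | zero : Wm ζ M (fun _ => 0)
  | add {u v} : Wm ζ M u → Wm ζ M v → Wm ζ M (fun x => u x + v x)
  | mono (c : ℂ) (hc : RR ζ c) (i : ℕ) (m : ℤ) (hm : |m| < M) :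
      Wm ζ M (fun x => c * (x : ℂ) ^ i * cexp (m * x))

lemma Wm.smul {ζ : ℂ} {M : ℕ} {u : ℝ → ℂ} (h : Wm ζ M u) {c : ℂ} (hc : RR ζ c) :
    Wm ζ M (fun x => c * u x) := by
  induction h with
  | zero => simpa using Wm.zero
  | add _ _ h1 h2 => simpa [mul_add] using h1.add h2
  | mono d hd i m hm => simpa [mul_assoc] using Wm.mono (c * d) (hc.mul hd) i m hm

lemma Wm.val {ζ : ℂ} (hζ : ζ ≠ 0) {M : ℕ} {u : ℝ → ℂ} (h : Wm ζ M u) : RR ζ (u 0) ∧ RR ζ (u 1) := by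
  induction h with
  | zero => exact ⟨RR.zero ζ, RR.zero ζ⟩
  | add _ _ h1 h2 => exact ⟨h1.1.add h2.1, h1.2.add h2.2⟩
  | mono d hd i m hm =>
    constructor
    · cases i with
      | zero => simpa using hd
      | succ i => simpa using RR.zero ζ
    · simpa using hd.mul ⟨_, Val.expz hζ m⟩

lemma Wm.part_mono (ζ : ℂ) (M : ℕ) (l : ℤ) (hl : |l| < M) (m : ℤ) (hm : |m| < M) (i : ℕ) :
    ∃ u, Wm ζ M u ∧ ∀ x : ℝ, HasDerivAt u (l * u x + (x : ℂ) ^ i * cexp (m * x)) x := by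
  have hd : ∀ (m : ℤ) (x : ℝ), HasDerivAt (fun x : ℝ => cexp (m * x)) (m * cexp (m * x)) x := by
    intro m x
    have := ((Complex.ofRealCLM.hasDerivAt (x := x)).const_mul (m : ℂ)).cexp
    simpa [mul_comm] using this
  have hp : ∀ (i : ℕ) (x : ℝ), HasDerivAt (fun x : ℝ => (x : ℂ) ^ i) (i * (x : ℂ) ^ (i - 1)) x := by
    intro i x
    have := ((Complex.ofRealCLM.hasDerivAt (x := x))).pow i
    refine HasDerivAt.congr_deriv (f := fun x : ℝ => (x : ℂ) ^ i) this ?_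
    simp
  by_cases hml : m = l
  · subst hml
    refine ⟨_, Wm.mono (((1 / (i + 1 : ℕ) : ℚ) : ℂ)) (RR.rat ζ _) (i + 1) m hm, fun x => ?_⟩
    have := (((hp (i + 1) x).const_mul (((1 / (i + 1 : ℕ) : ℚ) : ℂ)))).mul (hd m x)
    refine this.congr_deriv ?_
    have hi : (i : ℂ) + 1 ≠ 0 := by exact_mod_cast Nat.succ_ne_zero i
    simp only [Nat.add_sub_cancel]
    push_cast
    field_simp
    ring
  · have hne : ((m : ℂ) - l) ≠ 0 := by
      rw [sub_ne_zero]; exact_mod_cast hml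
    have hq : (((1 / (m - l) : ℚ)) : ℂ) = ((m : ℂ) - l)⁻¹ := by push_cast; simp
    induction i with
    | zero =>
      refine ⟨_, Wm.mono (((1 / (m - l) : ℚ)) : ℂ) (RR.rat ζ _) 0 m hm, fun x => ?_⟩
      have := (hd m x).const_mul (((1 / (m - l) : ℚ)) : ℂ)
      simp only [pow_zero, mul_one]
      refine this.congr_deriv ?_
      rw [hq]
      field_simp
      ring
    | succ i ih =>
      obtain ⟨u, hu, hu'⟩ := ih
      refine ⟨_, (Wm.mono (((1 / (m - l) : ℚ)) : ℂ) (RR.rat ζ _) (i + 1) m hm).add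
        (hu.smul (RR.rat ζ (-(i + 1) / (m - l)))), fun x => ?_⟩
      have := (((hp (i + 1) x).const_mul (((1 / (m - l) : ℚ) : ℂ))).mul (hd m x)).add
        ((hu' x).const_mul (((-(i + 1) / (m - l) : ℚ)) : ℂ))
      refine this.congr_deriv ?_
      simp only [Nat.add_sub_cancel]
      push_cast
      field_simp
      ring

lemma Wm.part {ζ : ℂ} {M : ℕ} (l : ℤ) (hl : |l| < M) {w : ℝ → ℂ} (hw : Wm ζ M w) :
    ∃ u, Wm ζ M u ∧ ∀ x : ℝ, HasDerivAt u (l * u x + w x) x := by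
  induction hw with
  | zero => exact ⟨_, Wm.zero, fun x => by simpa using hasDerivAt_const x (0 : ℂ)⟩
  | add _ _ h1 h2 =>
    obtain ⟨u, hu, hu'⟩ := h1
    obtain ⟨v, hv, hv'⟩ := h2
    exact ⟨_, hu.add hv, fun x => ((hu' x).add (hv' x)).congr_deriv (by ring)⟩
  | mono c hc i m hm =>
    obtain ⟨u, hu, hu'⟩ := Wm.part_mono ζ M l hl m hm i
    exact ⟨_, hu.smul hc, fun x => ((hu' x).const_mul c).congr_deriv (by ring)⟩

lemma Wm.bd {ζ : ℂ} (hζ : ζ ≠ 0) {M : ℕ} (hM : ∀ l : ℤ, |l| < M → ζ ^ l ≠ -1)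
    (l : ℤ) (hl : |l| < M) {w : ℝ → ℂ} (hw : Wm ζ M w) (d : ℂ) (hd : RR ζ d) :
    ∃ u, Wm ζ M u ∧ (∀ x : ℝ, HasDerivAt u (l * u x + w x) x) ∧ u 0 + u 1 = d := by
  obtain ⟨u, hu, hu'⟩ := hw.part l hl
  have hv : Val ζ (1 + cexp l) (1 + ζ ^ l) := by
    simpa using (Val.rat ζ 1).add (Val.expz hζ l)
  have h0 : 1 + ζ ^ l ≠ 0 := fun h => hM l hl (by linear_combination h)
  have h1 : 1 + cexp l ≠ 0 := by
    intro h
    rw [h] at hv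
    exact h0 hv.zero
  set c := (d + -(u 0 + u 1)) * (1 + cexp l)⁻¹ with hc
  have hcR : RR ζ c := (hd.add ((hu.val hζ).1.add (hu.val hζ).2).neg).mul ⟨_, hv.inv h0⟩
  refine ⟨_, hu.add (Wm.mono c hcR 0 l hl), fun x => ?_, ?_⟩
  · have hd : HasDerivAt (fun x : ℝ => cexp (l * x)) (l * cexp (l * x)) x := by
      have := ((Complex.ofRealCLM.hasDerivAt (x := x)).const_mul (l : ℂ)).cexp
      simpa [mul_comm] using this
    simp only [pow_zero, mul_one]
    exact ((hu' x).add (hd.const_mul c)).congr_deriv (by ring)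
  · have : c * (1 + cexp l) = d + -(u 0 + u 1) := by rw [hc]; field_simp
    simp
    linear_combination this

noncomputable def Ef (T : ℤ) (x : ℝ) : ℂ := cexp (T * x) / (1 + cexp T)
noncomputable def Ed (T : ℤ) (x : ℝ) : ℂ := (x - cexp T / (1 + cexp T)) * Ef T x

lemma one_add_exp_ne (T : ℤ) : 1 + cexp T ≠ 0 := by
  have h : (1 + cexp T) = ((1 + Real.exp T : ℝ) : ℂ) := by push_cast; rfl
  rw [h]
  have := Real.exp_pos T
  exact_mod_cast (by positivity : 1 + Real.exp (T:ℝ) ≠ 0)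

lemma Ef_deriv (T : ℤ) (x : ℝ) : HasDerivAt (Ef T) (T * Ef T x) x := by
  have := ((Complex.ofRealCLM.hasDerivAt (x := x)).const_mul (T : ℂ)).cexp
  have h2 : HasDerivAt (fun x : ℝ => cexp (T * x)) (T * cexp (T * x)) x := by
    simpa [mul_comm] using this
  exact (h2.div_const _).congr_deriv (by simp only [Ef]; ring)

lemma Ed_deriv (T : ℤ) (x : ℝ) : HasDerivAt (Ed T) (T * Ed T x + Ef T x) x := by
  have h1 : HasDerivAt (fun x : ℝ => (x : ℂ) - cexp T / (1 + cexp T)) 1 x := by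
    simpa using (Complex.ofRealCLM.hasDerivAt (x := x)).sub_const (cexp T / (1 + cexp T))
  exact (h1.mul (Ef_deriv T x)).congr_deriv (by simp only [Ed]; ring)

lemma Ef_bd (T : ℤ) : Ef T 0 + Ef T 1 = 1 := by
  have := one_add_exp_ne T
  simp only [Ef]; field_simp; simp

lemma Ed_bd (T : ℤ) : Ed T 0 + Ed T 1 = 0 := by
  have := one_add_exp_ne T
  simp only [Ed, Ef]; field_simp; simp; try ring

def Inv (ζ : ℂ) (M : ℕ) (T : ℤ) (v : ℝ → ℂ) : Prop := ∃ (a b : ℚ) (w : ℝ → ℂ), (a ≠ 0 ∨ b ≠ 0) ∧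
  Wm ζ M w ∧ ∀ x, v x = a * Ed T x + b * Ef T x + w x

lemma Inv.step {ζ : ℂ} (hζ : ζ ≠ 0) {M : ℕ} (hM : ∀ l : ℤ, |l| < M → ζ ^ l ≠ -1)
    {T : ℤ} (hT : |T| = M) (l : ℤ) (hl : |l| < M) {v : ℝ → ℂ} (hv : Inv ζ M T v) :
    ∃ u, Inv ζ M T u ∧ (∀ x : ℝ, HasDerivAt u (l * u x + v x) x) ∧ u 0 + u 1 = 0 := by
  obtain ⟨a, b, w, hab, hw, hv⟩ := hv
  have hne : (T : ℤ) - l ≠ 0 := by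
    intro h
    have : T = l := by omega
    subst this; omega
  have hneq : ((T : ℚ) - l) ≠ 0 := by exact_mod_cast hne
  have hnec : ((T : ℂ) - l) ≠ 0 := by exact_mod_cast hne
  set a' : ℚ := a / (T - l) with ha'
  set b' : ℚ := (b - a') / (T - l) with hb'
  obtain ⟨w', hw', hd, hbd⟩ := hw.bd hζ hM l hl (-(b' : ℂ)) (RR.rat ζ b').neg
  have ea : a = a' * (T - l) := by rw [ha']; field_simp
  have eb : b = b' * (T - l) + a' := by rw [hb']; field_simp; try ring
  have eac : (a : ℂ) = a' * (T - l) := by exact_mod_cast congrArg (fun q : ℚ => (q : ℂ)) ea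
  have ebc : (b : ℂ) = b' * (T - l) + a' := by exact_mod_cast congrArg (fun q : ℚ => (q : ℂ)) eb
  refine ⟨fun x => a' * Ed T x + b' * Ef T x + w' x, ⟨a', b', w', ?_, hw', fun x => rfl⟩, fun x => ?_, ?_⟩
  · by_contra! h
    rw [h.1] at ea eb
    rw [h.2] at eb
    simp at ea eb
    tauto
  · refine ((((Ed_deriv T x).const_mul (a' : ℂ)).add ((Ef_deriv T x).const_mul (b' : ℂ))).add
      (hd x)).congr_deriv ?_
    rw [hv, eac, ebc]
    ring
  · linear_combination hbd + a' * Ed_bd T + b' * Ef_bd T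

lemma Inv.ne {ζ : ℂ} (hζ : ζ ≠ 0) {M : ℕ} {T : ℤ} (hT : ζ ^ T = -1) {v : ℝ → ℂ}
    (hv : Inv ζ M T v) : v 0 ≠ 0 := by
  obtain ⟨a, b, w, hab, hw, hv⟩ := hv
  intro h0
  rw [hv] at h0
  obtain ⟨c, hc⟩ := (hw.val hζ).1
  have hne := one_add_exp_ne T
  simp only [Ed, Ef] at h0
  have h1 : (b : ℂ) * (1 + cexp T) + ((-a : ℚ) : ℂ) * cexp T + w 0 * ((1 + cexp T) * (1 + cexp T)) = 0 := by
    field_simp at h0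
    simp at h0
    push_cast
    linear_combination h0
  have hE := Val.expz hζ T
  rw [hT] at hE
  have hE1 : Val ζ (1 + cexp T) (1 + -1) := by simpa using (Val.rat ζ 1).add hE
  have h2 := (((Val.rat ζ b).mul hE1).add ((Val.rat ζ (-a)).mul hE)).add (hc.mul (hE1.mul hE1))
  rw [h1] at h2
  have h3 := h2.zero
  have ha : a = 0 := by simpa using h3
  rw [ha] at h1
  have h4 : (b : ℂ) + w 0 * (1 + cexp T) = 0 := by
    apply mul_right_cancel₀ hne
    simp at h1
    linear_combination h1
  have h5 := (Val.rat ζ b).add (hc.mul hE1)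
  rw [h4] at h5
  have h6 := h5.zero
  have hb : b = 0 := by simpa using h6
  tauto

lemma ode_unique (l : ℝ) (f u g : ℝ → ℂ) (hf : ∀ x, HasDerivAt f (l * f x + g x) x)
    (hu : ∀ x, HasDerivAt u (l * u x + g x) x) (hf1 : f 1 = -f 0) (hu1 : u 0 + u 1 = 0) (x : ℝ) :
    f x = u x := by
  have hd : ∀ x, HasDerivAt (fun x : ℝ => cexp (-(l * x)) * (f x - u x)) 0 x := by
    intro x
    have := (((Complex.ofRealCLM.hasDerivAt (x := x)).const_mul (l : ℂ)).neg).cexp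
    have h2 : HasDerivAt (fun x : ℝ => cexp (-(l * x))) (-l * cexp (-(l * x))) x := by
      simpa [mul_comm] using this
    exact (h2.mul ((hf x).sub (hu x))).congr_deriv (by simp only [Pi.sub_apply]; try ring)
  have hc : ∀ x y, cexp (-(l * (x:ℝ))) * (f x - u x) = cexp (-(l * (y:ℝ))) * (f y - u y) :=
    fun x y => is_const_of_deriv_eq_zero (fun x => (hd x).differentiableAt) (fun x => (hd x).deriv) x y
  have h1 := hc 1 0
  have hD : f 1 - u 1 = -(f 0 - u 0) := by linear_combination hf1 - hu1
  rw [hD] at h1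
  simp at h1
  have hp : (1 : ℂ) + cexp (-l) ≠ 0 := by
    have h : (1 + cexp (-l)) = ((1 + Real.exp (-l) : ℝ) : ℂ) := by push_cast; rfl
    rw [h]
    have := Real.exp_pos (-l)
    exact_mod_cast (by positivity : 1 + Real.exp (-l) ≠ 0)
  have h0 : f 0 - u 0 = 0 := by
    have : (1 + cexp (-l)) * (f 0 - u 0) = 0 := by linear_combination -h1
    exact (mul_eq_zero.1 this).resolve_left hp
  have h2 := hc x 0
  rw [h0, mul_zero] at h2
  exact sub_eq_zero.1 ((mul_eq_zero.1 h2).resolve_left (Complex.exp_ne_zero _))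

lemma kap_ne (l : ℝ) : cexp (-l) - (-1 : ℂ)⁻¹ ≠ 0 := by
  have h : cexp (-l) - (-1 : ℂ)⁻¹ = ((Real.exp (-l) + 1 : ℝ) : ℂ) := by
    push_cast; norm_num
  rw [h]
  have := Real.exp_pos (-l)
  exact_mod_cast (by positivity : Real.exp (-l) + 1 ≠ 0)

def Good (ζ : ℂ) (M : ℕ) (T : ℤ) (f : ℝ → ℂ) : Prop :=
  ∃ (K : ℂ) (v : ℝ → ℂ), K ≠ 0 ∧ Inv ζ M T v ∧ ∀ x, f x = K * v x

lemma good_step (ζ : ℂ) (M : ℕ) (T : ℤ) (l : ℤ) (L : List ℝ) (v u : ℝ → ℂ) (K : ℂ) (hK : K ≠ 0)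
    (hv : ∀ x, ch (-1) T L x = K * v x)
    (hu : Inv ζ M T u) (hd : ∀ x : ℝ, HasDerivAt u (l * u x + v x) x) (hb : u 0 + u 1 = 0) :
    Good ζ M T (ch (-1) T ((l : ℝ) :: L)) := by
  refine ⟨(cexp (-(l:ℝ)) - (-1 : ℂ)⁻¹) * K, u, mul_ne_zero (kap_ne _) hK, hu, ?_⟩
  refine ode_unique l _ _ (fun x => (cexp (-(l:ℝ)) - (-1 : ℂ)⁻¹) * (K * v x)) ?_ ?_ ?_ ?_
  · intro x
    have := ch_deriv (-1) T l L x
    rwa [hv] at this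
  · intro x
    exact ((hd x).const_mul _).congr_deriv (by push_cast; ring)
  · simpa using ch_bdry (-1) (by simp) T l L
  · linear_combination ((cexp (-(l:ℝ)) - (-1 : ℂ)⁻¹) * K) * hb

lemma good_nil (ζ : ℂ) (M : ℕ) (T : ℤ) : Inv ζ M T (Ef T) ∧ Inv ζ M T (Ed T) ∧
    ∀ x, ch (-1) T [] x = (cexp (-T) * (1 + cexp T)) * Ef T x := by
  refine ⟨⟨0, 1, _, by simp, Wm.zero, by simp⟩, ⟨1, 0, _, by simp, Wm.zero, by simp⟩, fun x => ?_⟩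
  have := one_add_exp_ne T
  simp only [ch, Ef]
  rw [mul_assoc, mul_div_cancel₀ _ this, ← Complex.exp_add]
  congr 1; push_cast; ring

lemma good_list {ζ : ℂ} (hζ : ζ ≠ 0) {M : ℕ} (hM : ∀ l : ℤ, |l| < M → ζ ^ l ≠ -1)
    {T : ℤ} (hT : |T| = M) (L0 : List ℝ) (h0 : Good ζ M T (ch (-1) T L0)) (L : List ℝ)
    (hL : ∀ x ∈ L, ∃ l : ℤ, x = l ∧ |l| < M) : Good ζ M T (ch (-1) T (L ++ L0)) := by
  induction L with
  | nil => simpa using h0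
  | cons y L ih =>
    obtain ⟨K, v, hK, hv, he⟩ := ih fun x hx => hL x (List.mem_cons_of_mem _ hx)
    obtain ⟨l, rfl, hl⟩ := hL y List.mem_cons_self
    obtain ⟨u, hu, hd, hb⟩ := hv.step hζ hM hT l hl
    exact good_step ζ M T l _ v u K hK he hu hd hb

lemma zeta_exists (M : ℕ) (hM : 0 < M) : ∃ ζ : ℂ, ζ ≠ 0 ∧ (∀ l : ℤ, |l| < M → ζ ^ l ≠ -1) ∧
    ∀ T : ℤ, |T| = M → ζ ^ T = -1 := by
  have hM' : (M : ℂ) ≠ 0 := by exact_mod_cast hM.ne'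
  have hpi : (Real.pi : ℂ) ≠ 0 := by exact_mod_cast Real.pi_ne_zero
  refine ⟨cexp (Real.pi * I / M), Complex.exp_ne_zero _, fun l hl h => ?_, fun T hT => ?_⟩
  · rw [← Complex.exp_int_mul, ← Complex.exp_pi_mul_I, Complex.exp_eq_exp_iff_exists_int] at h
    obtain ⟨m, hm⟩ := h
    have h1 : (l : ℂ) = M * (1 + 2 * m) := by
      have h3 : (Real.pi * I : ℂ) ≠ 0 := mul_ne_zero hpi I_ne_zero
      apply mul_right_cancel₀ h3
      field_simp at hm
      linear_combination (Real.pi * I : ℂ) * hm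
    have h2 : l = M * (1 + 2 * m) := by exact_mod_cast h1
    have h4 : 1 ≤ |1 + 2 * m| := Int.one_le_abs (by omega)
    rw [h2, abs_mul, Nat.abs_cast] at hl
    nlinarith
  · rw [← Complex.exp_int_mul]
    rcases abs_choice T with h | h
    · have : (T : ℂ) = M := by rw [h] at hT; exact_mod_cast hT
      rw [this, mul_div_cancel₀ _ hM', Complex.exp_pi_mul_I]
    · have : (T : ℂ) = -M := by
        rw [h] at hT
        have : T = -M := by omega
        rw [this]; push_cast; rfl
      rw [this, neg_mul, mul_div_cancel₀ _ hM', Complex.exp_neg, Complex.exp_pi_mul_I]; norm_num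

theorem ch_neg_one_ne (T : ℤ) (hT : T ≠ 0) (L : List ℝ) (dbl : Bool)
    (hL : ∀ x ∈ L, ∃ l : ℤ, x = l ∧ |l| < |T|) :
    ch (-1) T (L ++ (if dbl then [(T : ℝ)] else [])) 0 ≠ 0 := by
  obtain ⟨ζ, hζ, hM, hT1⟩ := zeta_exists T.natAbs (Int.natAbs_pos.2 hT)
  have hTM : |T| = (T.natAbs : ℤ) := (Int.natCast_natAbs T).symm
  rw [hTM] at hL
  obtain ⟨g1, g2, g3⟩ := good_nil ζ T.natAbs T
  have hK : cexp (-T) * (1 + cexp T) ≠ 0 := mul_ne_zero (Complex.exp_ne_zero _) (one_add_exp_ne T)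
  have h0 : Good ζ T.natAbs T (ch (-1) T (if dbl then [(T : ℝ)] else [])) := by
    cases dbl with
    | false => exact ⟨_, _, hK, g1, g3⟩
    | true => exact good_step ζ T.natAbs T T [] _ _ _ hK g3 g2 (Ed_deriv T) (Ed_bd T)
  obtain ⟨K, v, hK, hv, he⟩ := good_list hζ hM hTM _ h0 L hL
  rw [he]
  exact mul_ne_zero hK (hv.ne hζ (hT1 T hTM))

lemma prod_range_list (f : ℕ → ℂ) (p : ℕ) :
    ((List.range p).map f).prod = ∏ i ∈ Finset.range p, f i := by
  induction p with
  | zero => simp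
  | succ p ih => rw [List.range_succ, Finset.prod_range_succ, ← ih]; simp

lemma hf_pair (a ω : ℝ) (hω : ω ≠ 0) (h : cexp (-(I * ω)) = -1) :
    ∃ r : ℝ, 0 < r ∧ hf a ω * hf (-a) ω = -(r : ℂ) := by
  refine ⟨(Real.exp (-a) + 1) * (Real.exp a + 1) / (ω ^ 2 + a ^ 2), by positivity, ?_⟩
  have h1 : I * (ω : ℂ) ≠ (a : ℂ) := fun h => hω (eq_zero_of_I_mul h).2
  have h2 : I * (ω : ℂ) ≠ ((-a : ℝ) : ℂ) := fun h => hω (eq_zero_of_I_mul h).2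
  have hpos : ω ^ 2 + a ^ 2 ≠ 0 := by positivity
  have hc : (ω : ℂ) ^ 2 + (a : ℂ) ^ 2 ≠ 0 := by exact_mod_cast hpos
  have h1' := sub_ne_zero.2 h1
  have h2' := sub_ne_zero.2 h2
  rw [hf, hf, if_neg h1, if_neg h2, h]
  push_cast at h2' ⊢
  rw [div_mul_div_comm, ← neg_div, div_eq_div_iff (mul_ne_zero h1' h2') hc]
  simp only [neg_neg]
  linear_combination ((cexp (-a) + 1) * (cexp a + 1)) * (ω : ℂ) ^ 2 * I_sq

lemma sym_prod (k p : ℕ) (ω : ℝ) (hω : ω ≠ 0) (h : cexp (-(I * ω)) = -1) :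
    ∃ r : ℝ, 0 < r ∧ (∏ i ∈ Finset.range p, hf ((k : ℝ) + 2 * i) ω) *
      (∏ i ∈ Finset.range p, hf (-((k : ℝ) + 2 * i)) ω) = (-1) ^ p * (r : ℂ) := by
  induction p with
  | zero => exact ⟨1, one_pos, by simp⟩
  | succ p ih =>
    obtain ⟨r, hr, e⟩ := ih
    obtain ⟨s, hs, e'⟩ := hf_pair ((k : ℝ) + 2 * p) ω hω h
    refine ⟨r * s, mul_pos hr hs, ?_⟩
    rw [Finset.prod_range_succ, Finset.prod_range_succ, mul_mul_mul_comm, e, e']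
    push_cast; ring

noncomputable def LA (k p : ℕ) : List ℝ := (List.range p).map fun j : ℕ => (k : ℝ) + 2 * j
noncomputable def LB (n k p : ℕ) : List ℝ :=
  (List.range p).map fun j : ℕ => -(n : ℝ) - (k : ℝ) + 2 + 2 * j

lemma prod_LAB (n k p : ℕ) (F : ℝ → ℂ) : ((LA k p ++ LB n k p).map F).prod =
    (∏ i ∈ Finset.range p, F ((k : ℝ) + 2 * i)) *
      ∏ i ∈ Finset.range p, F (-(n : ℝ) - (k : ℝ) + 2 + 2 * i) := by
  rw [List.map_append, List.prod_append, LA, LB, List.map_map, List.map_map, prod_range_list,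
    prod_range_list]
  rfl

lemma prod_lam (n k p : ℕ) (lam : Fin (2 * p) → ℝ)
    (hlam : ∀ j : Fin (2 * p),
      lam j = if (j : ℕ) < p then (k : ℝ) + 2 * (j : ℕ)
              else -(n : ℝ) - (k : ℝ) + 2 + 2 * (((j : ℕ) - p : ℕ) : ℝ)) (F : ℝ → ℂ) :
    ((LA k p ++ LB n k p).map F).prod = ∏ j, F (lam j) := by
  rw [prod_LAB]
  have : ∏ j, F (lam j) = ∏ j ∈ Finset.range (2 * p), F (if j < p then (k : ℝ) + 2 * (j : ℕ)
              else -(n : ℝ) - (k : ℝ) + 2 + 2 * ((j - p : ℕ) : ℝ)) := by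
    rw [Finset.prod_range]
    exact Finset.prod_congr rfl fun j _ => by rw [hlam]
  rw [this, two_mul, Finset.prod_range_add]
  congr 1
  · exact Finset.prod_congr rfl fun j hj => by rw [if_pos (Finset.mem_range.1 hj)]
  · exact Finset.prod_congr rfl fun j hj => by simp

lemma neg_one_perm (n p k : ℕ) (hn : 2 ≤ n) (hp : 1 ≤ p) (hne : n ≠ 2 * p) :
    ∃ (a : ℝ) (M : List ℝ), M ≠ [] ∧ (LA k p ++ LB n k p).Perm (a :: M) ∧ ch (-1) a M 0 ≠ 0 := by
  obtain ⟨q, rfl⟩ : ∃ q, p = q + 1 := ⟨p - 1, by omega⟩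
  have hA : LA k (q + 1) = LA k q ++ [(k : ℝ) + 2 * q] := by simp [LA, List.range_succ]
  have hB : LB n k (q + 1) = LB n k q ++ [-(n : ℝ) - (k : ℝ) + 2 + 2 * q] := by
    simp [LB, List.range_succ]
  have mA : ∀ x ∈ LA k q, ∃ j : ℕ, j < q ∧ x = ((k + 2 * j : ℤ) : ℝ) := by
    intro x hx
    simp only [LA, List.mem_map, List.mem_range] at hx
    obtain ⟨j, hj, rfl⟩ := hx
    exact ⟨j, hj, by push_cast; ring⟩
  have mA' : ∀ x ∈ LA k (q + 1), ∃ j : ℕ, j < q + 1 ∧ x = ((k + 2 * j : ℤ) : ℝ) := by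
    intro x hx
    simp only [LA, List.mem_map, List.mem_range] at hx
    obtain ⟨j, hj, rfl⟩ := hx
    exact ⟨j, hj, by push_cast; ring⟩
  have mB : ∀ x ∈ LB n k q, ∃ j : ℕ, j < q ∧ x = ((-n - k + 2 + 2 * j : ℤ) : ℝ) := by
    intro x hx
    simp only [LB, List.mem_map, List.mem_range] at hx
    obtain ⟨j, hj, rfl⟩ := hx
    exact ⟨j, hj, by push_cast; ring⟩
  have mB' : ∀ x ∈ LB n k (q + 1), ∃ j : ℕ, j < q + 1 ∧ x = ((-n - k + 2 + 2 * j : ℤ) : ℝ) := by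
    intro x hx
    simp only [LB, List.mem_map, List.mem_range] at hx
    obtain ⟨j, hj, rfl⟩ := hx
    exact ⟨j, hj, by push_cast; ring⟩
  rcases lt_or_gt_of_ne hne with hlt | hgt
  · by_cases hd : n = 2 ∧ k = 0
    · obtain ⟨rfl, rfl⟩ := hd
      refine ⟨((2 * q : ℤ) : ℝ), (LA 0 q ++ LB 2 0 q) ++ [((2 * q : ℤ) : ℝ)], by simp, ?_, ?_⟩
      · rw [hA, hB]
        have e1 : ((0 : ℕ) : ℝ) + 2 * q = ((2 * q : ℤ) : ℝ) := by push_cast; ring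
        have e2 : -((2 : ℕ) : ℝ) - ((0 : ℕ) : ℝ) + 2 + 2 * q = ((2 * q : ℤ) : ℝ) := by push_cast; ring
        rw [e1, e2]
        have := (List.perm_middle (a := ((2 * q : ℤ) : ℝ)) (l₁ := LA 0 q) (l₂ := LB 2 0 q ++ [((2 * q : ℤ) : ℝ)]))
        simpa using this
      · have := ch_neg_one_ne (2 * q) (by omega) (LA 0 q ++ LB 2 0 q) true ?_
        · simpa using this
        · intro x hx
          rcases List.mem_append.1 hx with hx | hx
          · obtain ⟨j, hj, rfl⟩ := mA x hx
            exact ⟨_, rfl, by rw [abs_lt, abs_of_nonneg (by positivity : (0:ℤ) ≤ 2 * q)]; omega⟩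
          · obtain ⟨j, hj, rfl⟩ := mB x hx
            exact ⟨_, rfl, by rw [abs_lt, abs_of_nonneg (by positivity : (0:ℤ) ≤ 2 * q)]; omega⟩
    · refine ⟨((k + 2 * q : ℤ) : ℝ), LA k q ++ LB n k (q + 1), by simp [hB], ?_, ?_⟩
      · rw [hA]
        have e1 : (k : ℝ) + 2 * q = ((k + 2 * q : ℤ) : ℝ) := by push_cast; ring
        rw [e1]
        simpa using List.perm_middle (a := ((k + 2 * q : ℤ) : ℝ)) (l₁ := LA k q) (l₂ := LB n k (q + 1))
      · have := ch_neg_one_ne (k + 2 * q) (by omega) (LA k q ++ LB n k (q + 1)) false ?_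
        · simpa using this
        · intro x hx
          rcases List.mem_append.1 hx with hx | hx
          · obtain ⟨j, hj, rfl⟩ := mA x hx
            exact ⟨_, rfl, by rw [abs_lt, abs_of_nonneg (by positivity : (0:ℤ) ≤ k + 2 * q)]; omega⟩
          · obtain ⟨j, hj, rfl⟩ := mB' x hx
            exact ⟨_, rfl, by rw [abs_lt, abs_of_nonneg (by positivity : (0:ℤ) ≤ k + 2 * q)]; omega⟩
  · set M : List ℝ := (List.range q).map fun j : ℕ => -(n : ℝ) - (k : ℝ) + 2 + 2 * ((j + 1 : ℕ) : ℝ) with hM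
    have hB2 : LB n k (q + 1) = ((-n - k + 2 : ℤ) : ℝ) :: M := by
      rw [LB, List.range_succ_eq_map, List.map_cons, List.map_map]
      congr 1
      push_cast; ring
    refine ⟨((-n - k + 2 : ℤ) : ℝ), LA k (q + 1) ++ M, by simp [hA], ?_, ?_⟩
    · rw [hB2]
      exact List.perm_middle
    · have := ch_neg_one_ne (-n - k + 2) (by omega) (LA k (q + 1) ++ M) false ?_
      · simpa using this
      · intro x hx
        rcases List.mem_append.1 hx with hx | hx
        · obtain ⟨j, hj, rfl⟩ := mA' x hx
          exact ⟨_, rfl, by rw [abs_lt, abs_of_nonpos (by omega : (-n - k + 2 : ℤ) ≤ 0)]; omega⟩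
        · rw [hM] at hx
          simp only [List.mem_map, List.mem_range] at hx
          obtain ⟨j, hj, rfl⟩ := hx
          refine ⟨-n - k + 2 + 2 * (j + 1), by push_cast; ring, ?_⟩
          rw [abs_lt, abs_of_nonpos (by omega : (-n - k + 2 : ℤ) ≤ 0)]; omega

theorem final
    (n p k : ℕ) (hn : 2 ≤ n) (hp : 1 ≤ p)
    (lam : Fin (2 * p) → ℝ)
    (hlam : ∀ j : Fin (2 * p),
      lam j = if (j : ℕ) < p then (k : ℝ) + 2 * (j : ℕ)
              else -(n : ℝ) - (k : ℝ) + 2 + 2 * (((j : ℕ) - p : ℕ) : ℝ))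
    (Q : ℝ → ℝ) (hQc : Continuous Q)
    (hQsupp : Function.support Q ⊆ Set.Icc (0 : ℝ) (2 * p : ℝ))
    (hQF : ∀ ξ : ℝ, (∀ j, Complex.I * (ξ : ℂ) ≠ (lam j : ℂ)) →
      (∫ t : ℝ, Complex.exp (-(Complex.I * ξ * t)) * Q t) =
        ∏ j, (Complex.exp (-(lam j : ℂ)) - Complex.exp (-(Complex.I * ξ))) /
          (Complex.I * ξ - (lam j : ℂ))) :
    ∀ ξ : ℝ, (∑' j : ℤ, (Q j : ℂ) * Complex.exp (-(Complex.I * ξ * j))) ≠ 0 := by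
  intro ξ
  have hF : ∀ ξ : ℝ, ξ ≠ 0 → (∫ t : ℝ, cexp (-(I * ξ * t)) * Q t) =
      ((LA k p ++ LB n k p).map (fun l => hf l ξ)).prod := by
    intro ξ hξ
    have hne : ∀ j, I * (ξ : ℂ) ≠ (lam j : ℂ) := fun j h => hξ (eq_zero_of_I_mul h).2
    rw [prod_lam n k p lam hlam, hQF ξ hne]
    exact Finset.prod_congr rfl fun j _ => by rw [hf, if_neg (hne j)]
  have key : ∀ (a : ℝ) (M : List ℝ), M ≠ [] → (LA k p ++ LB n k p).Perm (a :: M) → 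
      HasSum (fun m : ℤ => ((LA k p ++ LB n k p).map (fun l => hf l (ξ + 2 * Real.pi * m))).prod)
        (∑' j : ℤ, (Q j : ℂ) * cexp (-(I * ξ * j))) ∧
      (∑' j : ℤ, (Q j : ℂ) * cexp (-(I * ξ * j))) = ch (cexp (I * ξ)) a M 0 := by
    intro a M hM hperm
    obtain ⟨l, L, rfl⟩ := List.exists_cons_of_ne_nil hM
    exact key_identity Q hQc (2 * p) hQsupp (LA k p ++ LB n k p) hF a l L hperm ξ
  obtain ⟨a, l, L, hL⟩ : ∃ a l L, LA k p ++ LB n k p = a :: l :: L := by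
    obtain ⟨q, rfl⟩ : ∃ q, p = q + 1 := ⟨p - 1, by omega⟩
    have : ∃ a M, LA k (q + 1) = a :: M := by
      rw [LA, List.range_succ_eq_map, List.map_cons]; exact ⟨_, _, rfl⟩
    obtain ⟨a, M, h⟩ := this
    rw [h, List.cons_append]
    have h2 : M ++ LB n k (q + 1) ≠ [] := by simp [LB]
    obtain ⟨l, L, h3⟩ := List.exists_cons_of_ne_nil h2
    exact ⟨a, l, L, by rw [h3]⟩
  have key0 := key a (l :: L) (by simp) (by rw [hL])
  by_cases h1 : cexp (I * ξ) = 1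
  · rw [key0.2, h1]
    obtain ⟨r, hr, e⟩ := ch_one_pos a (l :: L) 0 (by simp)
    rw [e]
    exact_mod_cast hr.ne'
  by_cases h2 : cexp (I * ξ) = -1
  swap
  · rw [key0.2]
    exact ch_ne_zero_generic ξ a l L h1 h2
  by_cases hnp : n = 2 * p
  swap
  · obtain ⟨b, M, hM, hperm, hch⟩ := neg_one_perm n p k hn hp hnp
    rw [(key b M hM hperm).2, h2]
    exact hch
  have hs := key0.1
  have hex : ∀ m : ℤ, cexp (-(I * ((ξ + 2 * Real.pi * m : ℝ) : ℂ))) = -1 := by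
    intro m
    have : -(I * ((ξ + 2 * Real.pi * m : ℝ) : ℂ)) = -(I * ξ) + ((-m : ℤ) : ℂ) * (2 * Real.pi * I) := by
      push_cast; ring
    rw [this, Complex.exp_add, Complex.exp_int_mul_two_pi_mul_I, Complex.exp_neg, h2]
    norm_num
  have hw : ∀ m : ℤ, (ξ + 2 * Real.pi * m : ℝ) ≠ 0 := by
    intro m h
    have := hex m
    rw [h] at this
    norm_num at this
  have hr : ∀ m : ℤ, ∃ r : ℝ, 0 < r ∧
      ((LA k p ++ LB n k p).map (fun l => hf l (ξ + 2 * Real.pi * m))).prod = (-1) ^ p * (r : ℂ) := by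
    intro m
    obtain ⟨r, hr, e⟩ := sym_prod k p _ (hw m) (hex m)
    refine ⟨r, hr, ?_⟩
    rw [← e, prod_LAB]
    congr 1
    rw [← Finset.prod_range_reflect]
    refine Finset.prod_congr rfl fun j hj => ?_
    have hj' := Finset.mem_range.1 hj
    congr 1
    rw [hnp, Nat.cast_sub (by omega), Nat.cast_sub (by omega)]
    push_cast; ring
  choose r hr0 hr1 using hr
  intro h0
  rw [h0] at hs
  simp only [hr1] at hs
  have hs2 := hs.mul_left ((-1 : ℂ) ^ p)
  simp only [← mul_assoc, ← mul_pow] at hs2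
  norm_num at hs2
  have hs3 : HasSum r 0 := Complex.hasSum_ofReal.1 (by simpa using hs2)
  have := (hasSum_zero_iff_of_nonneg fun m => (hr0 m).le).1 hs3
  have h3 := congrFun this 0
  exact (hr0 0).ne' h3

end TB



/-- Fix integers `n ≥ 2`, `p ≥ 1`, `k ≥ 0`, set `N = 2p`, and define
`Λ_k = [λ₁, …, λ_N]` by `λ_{1+j} = k + 2j` for `j = 0, …, p−1` and
`λ_{1+p+j} = −n − k + 2 + 2j` for `j = 0, …, p−1`.  Let `Q : ℝ → ℝ` be continuous, supported
in `[0, N]`, with Fourier transform `𝓕Q(ξ) = ∏_{j=1}^N (e^{−λ_j} − e^{−iξ})/(iξ − λ_j)`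
(for `iξ ≠ λ_j`).  Then `φ*(ξ) := Σ_{j∈ℤ} Q(j)·e^{−iξj} ≠ 0` for every `ξ ∈ ℝ`. -/
theorem statement10
    (n p k : ℕ) (hn : 2 ≤ n) (hp : 1 ≤ p)
    (lam : Fin (2 * p) → ℝ)
    (hlam : ∀ j : Fin (2 * p),
      lam j = if (j : ℕ) < p then (k : ℝ) + 2 * (j : ℕ)
              else -(n : ℝ) - (k : ℝ) + 2 + 2 * (((j : ℕ) - p : ℕ) : ℝ))
    (Q : ℝ → ℝ) (hQc : Continuous Q)
    (hQsupp : Function.support Q ⊆ Set.Icc (0 : ℝ) (2 * p : ℝ))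
    (hQF : ∀ ξ : ℝ, (∀ j, Complex.I * (ξ : ℂ) ≠ (lam j : ℂ)) →
      (∫ t : ℝ, Complex.exp (-(Complex.I * ξ * t)) * Q t) =
        ∏ j, (Complex.exp (-(lam j : ℂ)) - Complex.exp (-(Complex.I * ξ))) /
          (Complex.I * ξ - (lam j : ℂ))) :
    ∀ ξ : ℝ, (∑' j : ℤ, (Q j : ℂ) * Complex.exp (-(Complex.I * ξ * j))) ≠ 0 := by
  exact TB.final n p k hn hp lam hlam Q hQc hQsupp hQF
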